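/- arXiv:1410.3307 — 14 statements merged into one kernel-verified Lean document; each statement's English description precedes it below -/
import Mathlib

section
/- Let α > β ≥ 0 be reals, λ = α − β > 0, δ > 0, γ = δ/λ, q = β/α, ν > 0, μ = ν/α, τ > 0 and N = e^{δτ}. For every real z with 0 ≤ z < (1+q)/2 (so that |ξ| < 1 where ξ = (q−z)/(1−z)), the log-generating function of the mutant number satisfies the exact identity ν ∫_0^τ e^{δs} (φ_{τ−s}(z) − 1) ds = μ ∑_{k=0}^∞ ξ^k (N^{−k/γ} − N)/(γ + k), where φ_t(z) = 1 − (1−q)/(1 − ξ e^{−λt}). -/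
open Filter Topology

/-- Exact series identity for the log-generating function of the mutant number in the
semi-deterministic Luria–Delbrück model with exponential wild-type growth. -/
theorem luria_delbruck_loggen_series
    (α β δ ν τ z lam γ q μ N ξ : ℝ)
    (hβ : 0 ≤ β) (hαβ : β < α) (hδ : 0 < δ) (hν : 0 < ν) (hτ : 0 < τ)
    (hlam : lam = α - β) (hγ : γ = δ / lam) (hq : q = β / α) (hμ : μ = ν / α)
    (hN : N = Real.exp (δ * τ))
    (hz0 : 0 ≤ z) (hz1 : z < (1 + q) / 2)
    (hξ : ξ = (q - z) / (1 - z)) :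
    ν * ∫ s in (0:ℝ)..τ,
        Real.exp (δ * s) *
          ((1 - (1 - q) / (1 - ξ * Real.exp (-(lam * (τ - s))))) - 1)
      = μ * ∑' k : ℕ, ξ ^ k * (N ^ (-(k : ℝ) / γ) - N) / (γ + k) := by
  have hα : 0 < α := lt_of_le_of_lt hβ hαβ
  have hl : 0 < lam := by rw [hlam]; linarith
  have hq1 : q < 1 := by rw [hq, div_lt_one hα]; exact hαβ
  have hz : 0 < 1 - z := by linarith
  have hx : |ξ| < 1 := by
    rw [hξ, abs_lt, lt_div_iff₀ hz, div_lt_one hz]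
    constructor <;> linarith
  have hγ0 : 0 < γ := by rw [hγ]; positivity
  have key : HasSum (fun k : ℕ => ∫ s in (0:ℝ)..τ,
      ξ ^ k * (Real.exp (-(k * lam * τ)) * Real.exp ((δ + k * lam) * s)))
      (∫ s in (0:ℝ)..τ, Real.exp (δ * s) * (1 - ξ * Real.exp (-(lam * (τ - s))))⁻¹) := by
    apply intervalIntegral.hasSum_integral_of_dominated_convergence
      (fun k _ => |ξ| ^ k * Real.exp (δ * τ))
    · intro k
      exact Continuous.aestronglyMeasurable (by fun_prop)
    · intro k
      refine Filter.Eventually.of_forall fun s hs => ?_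
      rw [Set.uIoc_of_le hτ.le] at hs
      rw [norm_mul, norm_pow, Real.norm_eq_abs, ← Real.exp_add, Real.norm_eq_abs, Real.abs_exp]
      gcongr
      have : 0 ≤ ((k:ℝ) * lam) * (τ - s) := mul_nonneg (by positivity) (by linarith [hs.2])
      nlinarith [hs.2]
    · refine Filter.Eventually.of_forall fun s hs => ?_
      exact (summable_geometric_of_lt_one (abs_nonneg _) hx).mul_right _
    · exact intervalIntegrable_const
    · refine Filter.Eventually.of_forall fun s hs => ?_
      rw [Set.uIoc_of_le hτ.le] at hs
      have h1 : Real.exp (-(lam * (τ - s))) ≤ 1 := by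
        rw [Real.exp_le_one_iff]
        have := mul_nonneg hl.le (sub_nonneg.2 hs.2)
        linarith
      have h2 : ‖ξ * Real.exp (-(lam * (τ - s)))‖ < 1 := by
        rw [norm_mul, Real.norm_eq_abs, Real.norm_eq_abs, Real.abs_exp]
        exact lt_of_le_of_lt (mul_le_of_le_one_right (abs_nonneg _) h1) hx
      have h3 := (hasSum_geometric_of_norm_lt_one h2).mul_left (Real.exp (δ * s))
      refine (congrArg (fun f : ℕ → ℝ => HasSum f _) (funext fun k => ?_)).mpr h3
      rw [mul_pow, ← Real.exp_nat_mul, ← Real.exp_add, mul_left_comm, ← Real.exp_add]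
      congr 2
      ring
  have hL : (∫ s in (0:ℝ)..τ, Real.exp (δ * s) *
          ((1 - (1 - q) / (1 - ξ * Real.exp (-(lam * (τ - s))))) - 1))
      = -(1 - q) * ∫ s in (0:ℝ)..τ,
          Real.exp (δ * s) * (1 - ξ * Real.exp (-(lam * (τ - s))))⁻¹ := by
    rw [← intervalIntegral.integral_const_mul]
    congr 1
    ext s
    rw [div_eq_mul_inv]
    ring
  have hterm : ∀ k : ℕ, (∫ s in (0:ℝ)..τ,
      ξ ^ k * (Real.exp (-(k * lam * τ)) * Real.exp ((δ + k * lam) * s)))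
      = (-1 / lam) * (ξ ^ k * (N ^ (-(k : ℝ) / γ) - N) / (γ + k)) := by
    intro k
    have hc : 0 < δ + k * lam := by positivity
    have hN2 : N ^ (-(k : ℝ) / γ) = Real.exp (-(k * lam * τ)) := by
      rw [hN, ← Real.exp_mul, hγ]
      congr 1
      field_simp
    have hg : γ + k = (δ + k * lam) / lam := by rw [hγ]; field_simp
    rw [intervalIntegral.integral_const_mul, intervalIntegral.integral_const_mul,
      intervalIntegral.integral_comp_mul_left (fun x => Real.exp x) hc.ne', integral_exp,
      hN2, hg, hN]
    have e : Real.exp (δ * τ) = Real.exp (-(k * lam * τ)) * Real.exp ((δ + k * lam) * τ) := by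
      rw [← Real.exp_add]; congr 1; ring
    rw [e, mul_zero, Real.exp_zero, smul_eq_mul]
    field_simp
    ring
  rw [hL, ← key.tsum_eq, tsum_congr hterm, tsum_mul_left, hμ]
  have : 1 - q = lam / α := by rw [hq, hlam]; field_simp
  rw [this]
  field_simp
end

section
/- Let g : ℂ → ℂ be analytic at 0 and let f(z) = exp(g(z)). Denote by q_n and p_n the n-th Taylor coefficients of g and f at 0 respectively. Then p_0 = exp(q_0), and for every n ≥ 1 one has n · p_n = ∑_{k=0}^{n−1} (n − k) · q_{n−k} · p_k. -/
/-- Recursion for the Taylor coefficients of `f = exp ∘ g` in terms of those of `g`. -/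
theorem taylor_coeff_exp_recursion
    (g : ℂ → ℂ) (hg : AnalyticAt ℂ g 0)
    (f : ℂ → ℂ) (hf : f = fun z => Complex.exp (g z))
    (q p : ℕ → ℂ)
    (hq : ∀ n : ℕ, q n = iteratedDeriv n g 0 / (Nat.factorial n))
    (hp : ∀ n : ℕ, p n = iteratedDeriv n f 0 / (Nat.factorial n)) :
    p 0 = Complex.exp (q 0) ∧
      ∀ n : ℕ, 1 ≤ n →
        (n : ℂ) * p n = ∑ k ∈ Finset.range n, ((n : ℂ) - (k : ℂ)) * q (n - k) * p k := by
  refine ⟨by simp [hp, hq, hf], ?_⟩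
  intro n hn
  obtain ⟨m, rfl⟩ : ∃ m, n = m + 1 := ⟨n - 1, by omega⟩
  have hfa : AnalyticAt ℂ f 0 := by
    rw [hf]; exact hg.cexp
  have hev : deriv f =ᶠ[nhds 0] f * deriv g := by
    filter_upwards [hg.eventually_analyticAt] with z hz
    rw [hf]
    exact hz.differentiableAt.hasDerivAt.cexp.deriv
  have key : iteratedDeriv (m + 1) f 0 =
      ∑ i ∈ Finset.range (m + 1), (m.choose i : ℂ) * iteratedDeriv i f 0 *
        iteratedDeriv (m + 1 - i) g 0 := by
    rw [iteratedDeriv_succ', hev.iteratedDeriv_eq m,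
      iteratedDeriv_mul hfa.contDiffAt hg.deriv.contDiffAt]
    refine Finset.sum_congr rfl fun i hi => ?_
    have hi' := Finset.mem_range.1 hi
    rw [← iteratedDeriv_succ', show m + 1 - i = m - i + 1 by omega]
  rw [hp (m + 1), key, Finset.sum_div, Finset.mul_sum]
  refine Finset.sum_congr rfl fun i hi => ?_
  obtain ⟨j, rfl⟩ : ∃ j, m = i + j := ⟨m - i, by have := Finset.mem_range.1 hi; omega⟩
  rw [hq, hp, show i + j + 1 - i = j + 1 by omega, Nat.cast_add_choose]
  have h1 : ((i + j).factorial : ℂ) ≠ 0 := by exact_mod_cast Nat.factorial_ne_zero _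
  have h2 : (i.factorial : ℂ) ≠ 0 := by exact_mod_cast Nat.factorial_ne_zero _
  have h3 : (j.factorial : ℂ) ≠ 0 := by exact_mod_cast Nat.factorial_ne_zero _
  have h4 : ((i : ℂ) + j + 1) ≠ 0 := by exact_mod_cast Nat.succ_ne_zero (i + j)
  have h5 : ((j : ℂ) + 1) ≠ 0 := by exact_mod_cast Nat.succ_ne_zero j
  rw [Nat.factorial_succ (i + j), Nat.factorial_succ j]
  push_cast
  rw [show (i : ℂ) + j + 1 - i = j + 1 by ring]
  field_simp
end

section
/- Let γ > 0 be real, n ≥ 0 a natural number and k ≥ 1 an integer. Then (γ)_n · ∑_{j=1}^{k} C(k−1, j−1) · (−1)^j / (j+γ)_{n+1} = −γ · (n+1)_{k−1} / (n+γ)_{k+1}, where C(a,b) is the binomial coefficient. -/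
theorem poch_succ_left (n : ℕ) (x : ℝ) :
    (ascPochhammer ℝ (n + 1)).eval x = x * (ascPochhammer ℝ n).eval (x + 1) := by
  rw [ascPochhammer_succ_left]
  simp [Polynomial.eval_comp]

theorem poch_add (n m : ℕ) (x : ℝ) :
    (ascPochhammer ℝ n).eval x * (ascPochhammer ℝ m).eval (n + x)
      = (ascPochhammer ℝ (n + m)).eval x := by
  rw [← ascPochhammer_mul]
  simp [Polynomial.eval_comp, add_comm]

theorem poch_sum (n m : ℕ) : ∀ x : ℝ, 0 < x →
    ∑ i ∈ Finset.range (m + 1), (Nat.choose m i : ℝ) *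
        ((-1) ^ i / (ascPochhammer ℝ (n + 1)).eval (x + i))
      = (ascPochhammer ℝ m).eval ((n : ℝ) + 1) / (ascPochhammer ℝ (n + 1 + m)).eval x := by
  induction m with
  | zero => intro x hx; simp
  | succ m ih =>
    intro x hx
    have h := Finset.sum_choose_succ_mul
      (fun i _ => (-1 : ℝ) ^ i / (ascPochhammer ℝ (n + 1)).eval (x + i)) m
    have h2 := ih (x + 1) (by linarith)
    have h3 : ∑ i ∈ Finset.range (m + 1), (Nat.choose m i : ℝ) *
        ((-1 : ℝ) ^ (i + 1) / (ascPochhammer ℝ (n + 1)).eval (x + ((i + 1 : ℕ) : ℝ)))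
        = - ((ascPochhammer ℝ m).eval ((n : ℝ) + 1)
          / (ascPochhammer ℝ (n + 1 + m)).eval (x + 1)) := by
      rw [← h2, ← Finset.sum_neg_distrib]
      refine Finset.sum_congr rfl fun i _ => ?_
      have : x + ((i + 1 : ℕ) : ℝ) = x + 1 + i := by push_cast; ring
      rw [this]; ring
    have h1 := ih x hx
    rw [h1, h3] at h
    rw [h]
    have e1 := poch_succ_left (n + 1 + m) x
    have e2 := ascPochhammer_succ_eval (n + 1 + m) x
    have p1 := ascPochhammer_pos (n + 1 + m) x hx
    have p2 := ascPochhammer_pos (n + 1 + m) (x + 1) (by linarith)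
    have p3 := ascPochhammer_pos (n + 1 + m + 1) x hx
    rw [show n + 1 + (m + 1) = n + 1 + m + 1 by ring, ascPochhammer_succ_eval m]
    generalize (ascPochhammer ℝ (n + 1 + m)).eval x = A at *
    generalize (ascPochhammer ℝ (n + 1 + m)).eval (x + 1) = B at *
    generalize (ascPochhammer ℝ (n + 1 + m + 1)).eval x = C at *
    have q : 0 < x + ((n + 1 + m : ℕ) : ℝ) := by positivity
    have a1 : 1 / A = (x + ((n + 1 + m : ℕ) : ℝ)) / C := by rw [e2]; field_simp
    have a2 : 1 / B = x / C := by rw [e1]; field_simp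
    rw [div_eq_mul_one_div _ A, div_eq_mul_one_div _ B, a1, a2]
    push_cast
    ring

/-- Binomial sum identity from the Chu–Vandermonde identity:
`(γ)_n · ∑_{j=1}^k C(k−1,j−1)(−1)^j/(j+γ)_{n+1} = −γ·(n+1)_{k−1}/(n+γ)_{k+1}`. -/
theorem pochhammer_binomial_sum_identity
    (γ : ℝ) (hγ : 0 < γ) (n : ℕ) (k : ℕ) (hk : 1 ≤ k) :
    (ascPochhammer ℝ n).eval γ *
        ∑ j ∈ Finset.Icc 1 k,
          (Nat.choose (k - 1) (j - 1) : ℝ) * (-1) ^ j /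
            (ascPochhammer ℝ (n + 1)).eval ((j : ℝ) + γ)
      = -γ * (ascPochhammer ℝ (k - 1)).eval ((n : ℝ) + 1) /
          (ascPochhammer ℝ (k + 1)).eval ((n : ℝ) + γ) := by
  obtain ⟨m, rfl⟩ : ∃ m, k = m + 1 := ⟨k - 1, by omega⟩
  have hs : ∑ j ∈ Finset.Icc 1 (m + 1),
          (Nat.choose (m + 1 - 1) (j - 1) : ℝ) * (-1) ^ j /
            (ascPochhammer ℝ (n + 1)).eval ((j : ℝ) + γ)
      = - ((ascPochhammer ℝ m).eval ((n : ℝ) + 1)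
          / (ascPochhammer ℝ (n + 1 + m)).eval (γ + 1)) := by
    rw [← poch_sum n m (γ + 1) (by linarith), ← Finset.sum_neg_distrib,
      ← Finset.Ico_add_one_right_eq_Icc, Finset.sum_Ico_eq_sum_range]
    refine Finset.sum_congr (by simp) fun i _ => ?_
    have : ((1 + i : ℕ) : ℝ) + γ = γ + 1 + i := by push_cast; ring
    rw [this, Nat.add_sub_cancel, Nat.add_sub_cancel_left]
    ring
  rw [hs, Nat.add_sub_cancel]
  have e1 := poch_add n (m + 1 + 1) γ
  rw [show n + (m + 1 + 1) = n + 1 + m + 1 by ring, poch_succ_left (n + 1 + m) γ] at e1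
  have p1 := ascPochhammer_pos (n + 1 + m) (γ + 1) (by linarith)
  have p2 := ascPochhammer_pos (m + 1 + 1) (n + γ) (by positivity)
  rw [← neg_div, mul_div_assoc', div_eq_div_iff p1.ne' p2.ne']
  linear_combination (-(ascPochhammer ℝ m).eval ((n : ℝ) + 1)) * e1
end

section
/- Let γ > 0 be real, n ≥ 0 a natural number, k ≥ 1 an integer and z a real number. Then (γ)_n · ∑_{j=1}^{k} C(k−1, j−1) · (−1)^j z^{j−1} / (j+γ)_{n+1} = −(γ / ((γ+n)(γ+n+1))) · ∑_{m=0}^{k−1} ((1−k)_m (1+γ)_m / ((2+n+γ)_m · m!)) · z^m, where C(a,b) is the binomial coefficient. -/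
theorem aux_asc_add (a : ℝ) (n m : ℕ) : (ascPochhammer ℝ (n + m)).eval a =
    (ascPochhammer ℝ n).eval a * (ascPochhammer ℝ m).eval (a + n) := by
  rw [← ascPochhammer_mul]
  simp [Polynomial.eval_comp]

theorem aux_asc_neg (K m : ℕ) : (ascPochhammer ℝ m).eval (-(K : ℝ)) =
    (-1) ^ m * (Nat.factorial m) * (Nat.choose K m) := by
  rw [ascPochhammer_eval_neg_eq_descPochhammer, descPochhammer_eval_eq_descFactorial,
    Nat.descFactorial_eq_factorial_mul_choose]
  push_cast
  ring

theorem aux_key (γ : ℝ) (n m : ℕ) :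
    (ascPochhammer ℝ n).eval γ * ((γ + n) * (γ + n + 1)) * (ascPochhammer ℝ m).eval (2 + (n : ℝ) + γ)
    = γ * (ascPochhammer ℝ m).eval (1 + γ) *
      (ascPochhammer ℝ (n + 1)).eval (((1 + m : ℕ) : ℝ) + γ) := by
  have h1 := aux_asc_add γ (n + 1 + 1) m
  have h2 := aux_asc_add γ 1 (m + (n + 1))
  rw [aux_asc_add (γ + (1 : ℕ)) m (n + 1)] at h2
  rw [ascPochhammer_succ_eval, ascPochhammer_succ_eval] at h1
  rw [show 1 + (m + (n + 1)) = n + 1 + 1 + m by ring, h1, ascPochhammer_one] at h2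
  push_cast at h2 ⊢
  rw [Polynomial.eval_X] at h2
  rw [show 2 + (n : ℝ) + γ = γ + (n + 1 + 1) by ring, show 1 + γ = γ + 1 by ring,
    show 1 + (m : ℝ) + γ = γ + 1 + m by ring]
  linear_combination h2

/-- Polynomial identity: the binomial Pochhammer sum equals a terminating Gauss
hypergeometric sum `₂F₁(1−k, 1+γ; 2+n+γ; z)` up to a prefactor. -/
theorem pochhammer_binomial_sum_polynomial_identity
    (γ : ℝ) (hγ : 0 < γ) (n : ℕ) (k : ℕ) (hk : 1 ≤ k) (z : ℝ) :
    (ascPochhammer ℝ n).eval γ *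
        ∑ j ∈ Finset.Icc 1 k,
          (Nat.choose (k - 1) (j - 1) : ℝ) * (-1) ^ j * z ^ (j - 1) /
            (ascPochhammer ℝ (n + 1)).eval ((j : ℝ) + γ)
      = -(γ / ((γ + n) * (γ + n + 1))) *
          ∑ m ∈ Finset.range k,
            ((ascPochhammer ℝ m).eval (1 - (k : ℝ)) * (ascPochhammer ℝ m).eval (1 + γ) /
              ((ascPochhammer ℝ m).eval (2 + (n : ℝ) + γ) * (Nat.factorial m))) * z ^ m := by

  obtain ⟨K, rfl⟩ : ∃ K, k = K + 1 := ⟨k - 1, by omega⟩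
  rw [← Finset.Ico_add_one_right_eq_Icc, Finset.sum_Ico_eq_sum_range, Finset.mul_sum,
    Finset.mul_sum]
  refine Finset.sum_congr rfl fun m _ => ?_
  have key := aux_key γ n m
  rw [show (1 : ℝ) - ((K + 1 : ℕ) : ℝ) = -(K : ℝ) by push_cast; ring, aux_asc_neg]
  have p1 : (ascPochhammer ℝ (n + 1)).eval (((1 + m : ℕ) : ℝ) + γ) ≠ 0 :=
    (ascPochhammer_pos _ _ (by positivity)).ne'
  have p2 : (ascPochhammer ℝ m).eval (2 + (n : ℝ) + γ) ≠ 0 :=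
    (ascPochhammer_pos _ _ (by positivity)).ne'
  have p3 : γ + n ≠ 0 := by positivity
  have p4 : γ + n + 1 ≠ 0 := by positivity
  have p5 : (Nat.factorial m : ℝ) ≠ 0 := by positivity
  simp only [Nat.add_sub_cancel, Nat.add_sub_cancel_left]
  generalize (ascPochhammer ℝ (n + 1)).eval (((1 + m : ℕ) : ℝ) + γ) = A at *
  generalize (ascPochhammer ℝ m).eval (2 + (n : ℝ) + γ) = B at *
  generalize (ascPochhammer ℝ m).eval (1 + γ) = C at *
  generalize (ascPochhammer ℝ n).eval γ = D at *
  have e : D / A = γ * C / ((γ + n) * (γ + n + 1) * B) := by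
    rw [div_eq_div_iff p1 (by positivity)]
    linear_combination key
  calc _ = -((K.choose m : ℝ) * (-1) ^ m * z ^ m) * (D / A) := by ring
    _ = _ := by
      rw [e]
      field_simp
end

section
/- Let γ > 0, q ∈ [0,1) and c ∈ (0,1] be reals. Define ξ(z) = (q−z)/(1−z), h(z) = ∑_{n=0}^∞ (γ/(γ+n)) (c·ξ(z))^n, and for j ≥ 1 define H_j(w) = ∑_{n=0}^∞ ((1+j)_n (γ+j)_n / ((1+γ+j)_n · n!)) w^n for |w| < 1. Then for every integer k ≥ 1 and every real z in a neighborhood of 0 with |c·ξ(z)| < 1, the k-th derivative of h satisfies h^{(k)}(z) = k! · ∑_{j=1}^{k} C(k−1, j−1) · (γ/(γ+j)) · ((q−1)c)^j / (1−z)^{j+k} · H_j(c·ξ(z)). -/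
open Finset in
lemma aux_sum (m : ℕ) (X : ℕ → ℝ) :
    ∑ i ∈ range (m+1), ((m.choose i : ℝ) * ((i:ℝ)+m+2) * X i + (m.choose i : ℝ) * ((i:ℝ)+2) * X (i+1))
      = ((m:ℝ)+2) * ∑ i ∈ range (m+2), ((m+1).choose i : ℝ) * X i := by
  have e1 : ∑ i ∈ range (m+1), (m.choose i : ℝ) * i * X i
      = ∑ i ∈ range (m+1), (m.choose i : ℝ) * ((m:ℝ) - i) * X (i+1) := by
    have : ∑ i ∈ range (m+1), (m.choose i : ℝ) * i * X i
        = ∑ i ∈ range (m+2), (m.choose i : ℝ) * i * X i := by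
      rw [sum_range_succ _ (m+1)]; simp
    rw [this, sum_range_succ' _ (m+1)]
    simp only [Nat.cast_zero, mul_zero, zero_mul, add_zero]
    refine sum_congr rfl fun i hi => ?_
    have hi' : i ≤ m := by simpa [Nat.lt_succ_iff] using hi
    have := Nat.choose_succ_right_eq m i
    have h2 : ((m.choose (i+1) : ℝ)) * ((i:ℝ)+1) = m.choose i * ((m:ℝ) - i) := by
      rw [← Nat.cast_sub hi']; exact_mod_cast this
    push_cast
    rw [h2]
  have e2 : ∑ i ∈ range (m+2), ((m+1).choose i : ℝ) * X i
      = ∑ i ∈ range (m+1), (m.choose i : ℝ) * X (i+1) + ∑ i ∈ range (m+1), (m.choose i : ℝ) * X i := by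
    have : ∑ i ∈ range (m+1), (m.choose i : ℝ) * X i
        = ∑ i ∈ range (m+2), (m.choose i : ℝ) * X i := by
      rw [sum_range_succ _ (m+1)]; simp
    rw [this, sum_range_succ' _ (m+1), sum_range_succ' _ (m+1)]
    simp only [Nat.choose_succ_succ, Nat.choose_zero_right, Nat.cast_add, add_mul, sum_add_distrib]
    ring
  have e3 : ∑ i ∈ range (m+1), ((m.choose i : ℝ) * ((i:ℝ)+m+2) * X i + (m.choose i : ℝ) * ((i:ℝ)+2) * X (i+1))
      = ∑ i ∈ range (m+1), (m.choose i : ℝ) * i * X i + ((m:ℝ)+2) * ∑ i ∈ range (m+1), (m.choose i : ℝ) * X i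
        + ∑ i ∈ range (m+1), (m.choose i : ℝ) * ((i:ℝ)+2) * X (i+1) := by
    rw [mul_sum, ← sum_add_distrib, ← sum_add_distrib]
    exact sum_congr rfl fun i _ => by ring
  rw [e3, e1, e2, mul_add, mul_sum, mul_sum, add_right_comm, ← sum_add_distrib]
  congr 1
  exact sum_congr rfl fun i _ => by ring

noncomputable def auxG (γ : ℝ) (j : ℕ) (w : ℝ) : ℝ :=
  ∑' n : ℕ, ((n+j).choose j : ℝ) * (γ / (γ + n + j)) * w ^ n

lemma poch_shift (x : ℝ) (n : ℕ) :
    (ascPochhammer ℝ n).eval x * (x + n) = x * (ascPochhammer ℝ n).eval (1 + x) := by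
  induction n with
  | zero => simp
  | succ n ih =>
    rw [ascPochhammer_succ_eval, ascPochhammer_succ_eval, ih]; push_cast; ring

lemma poch_fact (j n : ℕ) :
    (ascPochhammer ℝ n).eval (1 + (j:ℝ)) * (j.factorial : ℝ) = ((n+j).factorial : ℝ) := by
  induction n with
  | zero => simp
  | succ n ih =>
    rw [ascPochhammer_succ_eval, show n + 1 + j = (n+j)+1 by ring, Nat.factorial_succ, Nat.cast_mul, ← ih]
    push_cast; ring

lemma coef_eq (γ : ℝ) (hγ : 0 < γ) (j n : ℕ) :
    γ / (γ + j) * ((ascPochhammer ℝ n).eval (1 + (j : ℝ)) * (ascPochhammer ℝ n).eval (γ + j) /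
          ((ascPochhammer ℝ n).eval (1 + γ + j) * (Nat.factorial n)))
      = ((n+j).choose j : ℝ) * (γ / (γ + n + j)) := by
  have h1 := poch_fact j n
  have h2 := poch_shift (γ + j) n
  rw [← add_assoc] at h2
  have h3 : ((n+j).choose j : ℝ) * n.factorial * j.factorial = ((n+j).factorial : ℝ) := by
    have := Nat.add_choose_mul_factorial_mul_factorial n j
    exact_mod_cast this
  have p1 : 0 < (ascPochhammer ℝ n).eval (1 + γ + j) := ascPochhammer_pos _ _ (by positivity)
  have p2 : (0:ℝ) < n.factorial := by positivity
  have p3 : (0:ℝ) < j.factorial := by positivity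
  have h4 : (ascPochhammer ℝ n).eval (1 + (j:ℝ)) = ((n+j).choose j : ℝ) * n.factorial := by
    apply mul_right_cancel₀ p3.ne'; rw [h1, h3]
  have p4 : 0 < γ + j + n := by positivity
  have p5 : 0 < γ + j := by positivity
  have h5 : (ascPochhammer ℝ n).eval (γ + j) = (γ + j) * (ascPochhammer ℝ n).eval (1 + γ + j) / (γ + j + n) := by
    rw [eq_div_iff p4.ne', h2]
  rw [h4, h5, show γ + n + j = γ + j + n by ring]
  field_simp

lemma coef_le (γ : ℝ) (hγ : 0 < γ) (j n : ℕ) :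
    0 ≤ γ / (γ + n + j) ∧ γ / (γ + n + j) ≤ 1 := by
  refine ⟨by positivity, ?_⟩
  rw [div_le_one (by positivity)]
  have : (0:ℝ) ≤ n := by positivity
  have : (0:ℝ) ≤ j := by positivity
  linarith

lemma auxG_summable (γ : ℝ) (hγ : 0 < γ) (j : ℕ) (w : ℝ) (hw : |w| < 1) :
    Summable fun n : ℕ => ((n+j).choose j : ℝ) * (γ / (γ + n + j)) * w ^ n := by
  have := summable_choose_mul_geometric_of_norm_lt_one (R := ℝ) j (r := |w|) (by simpa using hw)
  refine Summable.of_norm_bounded this fun n => ?_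
  obtain ⟨h1, h2⟩ := coef_le γ hγ j n
  rw [norm_mul, norm_mul, norm_pow, Real.norm_eq_abs w, Real.norm_of_nonneg h1, Real.norm_of_nonneg (by positivity)]
  gcongr
  exact mul_le_of_le_one_right (by positivity) h2

lemma auxG_deriv (γ : ℝ) (hγ : 0 < γ) (j : ℕ) (w : ℝ) (hw : |w| < 1) :
    HasDerivAt (auxG γ j) (((j:ℝ)+1) * auxG γ (j+1) w) w := by
  obtain ⟨r, hwr, hr⟩ := exists_between hw
  have hr0 : 0 < r := (abs_nonneg _).trans_lt hwr
  have hch : ∀ n : ℕ, ((n+1+j).choose j : ℝ) * ((n:ℝ)+1) = ((j:ℝ)+1) * ((n+(j+1)).choose (j+1) : ℝ) := by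
    intro n
    have := Nat.choose_succ_right_eq (n+1+j) j
    rw [show n + 1 + j - j = n+1 by omega] at this
    rw [show n + (j+1) = n+1+j by ring, mul_comm ((j:ℝ)+1)]
    exact_mod_cast this.symm
  have hu : Summable fun n : ℕ => ((n+j).choose j : ℝ) * (n * r ^ (n-1)) := by
    rw [← summable_nat_add_iff 1]
    have := (summable_choose_mul_geometric_of_norm_lt_one (R := ℝ) (j+1) (r := r)
      (by rwa [Real.norm_of_nonneg hr0.le])).mul_left ((j:ℝ)+1)
    refine this.congr fun n => ?_
    rw [← mul_assoc, ← hch]; simp only [Nat.add_sub_cancel]; push_cast; ring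
  have key := hasDerivAt_tsum_of_isPreconnected (t := Metric.ball (0:ℝ) r)
    (g := fun n w => ((n+j).choose j : ℝ) * (γ / (γ + n + j)) * w ^ n)
    (g' := fun n w => ((n+j).choose j : ℝ) * (γ / (γ + n + j)) * (n * w ^ (n-1)))
    (y₀ := w) (y := w) hu Metric.isOpen_ball (convex_ball _ _).isPreconnected
    (fun n y _ => (hasDerivAt_pow n y).const_mul _)
    (fun n y hy => by
      obtain ⟨h1, h2⟩ := coef_le γ hγ j n
      have hy' : |y| ≤ r := by simpa using (Metric.mem_ball.1 hy).le
      rw [norm_mul, norm_mul, norm_mul, norm_pow, Real.norm_eq_abs y, Real.norm_of_nonneg h1,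
        Real.norm_of_nonneg (by positivity), Real.norm_of_nonneg (by positivity)]
      gcongr
      exact mul_le_of_le_one_right (by positivity) h2)
    (by simpa using hwr) (auxG_summable γ hγ j w hw) (by simpa using hwr)
  have hs : Summable fun n : ℕ => ((n+j).choose j : ℝ) * (γ / (γ + n + j)) * (n * w ^ (n-1)) := by
    refine Summable.of_norm_bounded hu fun n => ?_
    obtain ⟨h1, h2⟩ := coef_le γ hγ j n
    rw [norm_mul, norm_mul, norm_mul, norm_pow, Real.norm_eq_abs w, Real.norm_of_nonneg h1,
        Real.norm_of_nonneg (by positivity), Real.norm_of_nonneg (by positivity)]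
    gcongr
    exact mul_le_of_le_one_right (by positivity) h2
  refine HasDerivAt.congr_deriv (f := auxG γ j) key ?_
  symm
  rw [hs.tsum_eq_zero_add, auxG, ← tsum_mul_left]
  simp only [Nat.cast_zero, zero_mul, mul_zero, zero_add]
  refine tsum_congr fun n => ?_
  rw [← mul_assoc, ← mul_assoc, ← hch]
  push_cast
  rw [show γ + (n:ℝ) + ((j:ℝ)+1) = γ + (n+1) + j by ring]
  ring

lemma aux_main (γ q c : ℝ) (hγ : 0 < γ) (U : Set ℝ) (hU : IsOpen U)
    (hU1 : ∀ z ∈ U, z < 1) (hU2 : ∀ z ∈ U, |c * ((q - z) / (1 - z))| < 1)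
    (h : ℝ → ℝ) (hh : ∀ z : ℝ, h z = auxG γ 0 (c * ((q - z) / (1 - z)))) (m : ℕ) :
    ∀ z ∈ U, iteratedDeriv (m+1) h z = ((m+1).factorial : ℝ) *
      ∑ i ∈ Finset.range (m+1), (m.choose i : ℝ) * (((q-1)*c)^(i+1) / (1-z)^(i+m+2) *
        auxG γ (i+1) (c * ((q - z) / (1 - z)))) := by
  have hξ : ∀ z ∈ U, HasDerivAt (fun z : ℝ => c * ((q - z) / (1 - z))) ((q-1)*c/(1-z)^2) z := by
    intro z hz
    have h1 : (1 - z) ≠ 0 := by have := hU1 z hz; linarith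
    have := ((((hasDerivAt_id z).const_sub q).div ((hasDerivAt_id z).const_sub 1) h1).const_mul c)
    refine this.congr_deriv ?_
    simp only [id]
    field_simp
    ring
  have hG : ∀ j : ℕ, ∀ z ∈ U, HasDerivAt (fun z : ℝ => auxG γ j (c * ((q - z) / (1 - z))))
      (((j:ℝ)+1) * auxG γ (j+1) (c * ((q - z) / (1 - z))) * ((q-1)*c/(1-z)^2)) z := by
    intro j z hz
    exact (auxG_deriv γ hγ j _ (hU2 z hz)).comp z (hξ z hz)
  induction m with
  | zero =>
    intro z hz
    have : h = fun z : ℝ => auxG γ 0 (c * ((q - z) / (1 - z))) := funext hh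
    simp only [zero_add, iteratedDeriv_one]
    rw [this, (hG 0 z hz).deriv]
    simp
    ring
  | succ m ih =>
    intro z hz
    have h1 : (1 - z) ≠ 0 := by have := hU1 z hz; linarith
    have hp : ∀ p : ℕ, HasDerivAt (fun z : ℝ => 1 / (1-z)^p) (p / (1-z)^(p+1)) z := by
      intro p
      have := (((hasDerivAt_id z).const_sub 1).pow p).inv (pow_ne_zero p h1)
      simp only [one_div]
      refine this.congr_deriv ?_
      simp only [id, Pi.pow_apply]
      rcases p with _ | p
      · simp
      · simp only [Nat.add_sub_cancel]
        field_simp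
        ring
    rw [iteratedDeriv_succ]
    have ev : iteratedDeriv (m+1) h =ᶠ[nhds z] fun z => ((m+1).factorial : ℝ) *
      ∑ i ∈ Finset.range (m+1), (m.choose i : ℝ) * (((q-1)*c)^(i+1) * (1 / (1-z)^(i+m+2)) *
        auxG γ (i+1) (c * ((q - z) / (1 - z)))) := by
      filter_upwards [hU.mem_nhds hz] with y hy
      rw [ih y hy]
      simp only [mul_one_div]
    rw [ev.deriv_eq]
    have hd := (HasDerivAt.fun_sum (u := Finset.range (m+1)) fun i _ =>
      ((((hp (i+m+2)).const_mul (((q-1)*c)^(i+1))).mul (hG (i+1) z hz)).const_mul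
        (m.choose i : ℝ))).const_mul ((m+1).factorial : ℝ)
    refine hd.deriv.trans ?_
    have := aux_sum m (fun i => ((q-1)*c)^(i+1) / (1-z)^(i+(m+1)+2) *
        auxG γ (i+1) (c * ((q - z) / (1 - z))))
    rw [Nat.factorial_succ (m+1), Nat.cast_mul, mul_comm ((m+1+1 : ℕ) : ℝ), mul_assoc]
    congr 1
    rw [show (((m+1+1 : ℕ)) : ℝ) = (m:ℝ)+2 by push_cast; ring]
    refine Eq.trans ?_ this
    refine Finset.sum_congr rfl fun i _ => ?_
    push_cast
    rw [show i + (m+1) + 2 = i+m+2+1 by ring, show i + 1 + (m+1) + 2 = i+m+2+2 by ring]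
    field_simp
    ring


/-- Derivatives of the hypergeometric function `h(z) = ∑ (γ/(γ+n))(c·ξ(z))^n` appearing in
the Luria–Delbrück log-generating function, expressed via shifted hypergeometric functions. -/
theorem hypergeometric_iterated_deriv_formula
    (γ q c : ℝ) (hγ : 0 < γ) (hq0 : 0 ≤ q) (hq1 : q < 1) (hc0 : 0 < c) (hc1 : c ≤ 1)
    (ξ : ℝ → ℝ) (hξ : ∀ z : ℝ, ξ z = (q - z) / (1 - z))
    (h : ℝ → ℝ) (hh : ∀ z : ℝ, h z = ∑' n : ℕ, (γ / (γ + n)) * (c * ξ z) ^ n)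
    (H : ℕ → ℝ → ℝ)
    (hH : ∀ j : ℕ, 1 ≤ j → ∀ w : ℝ, |w| < 1 →
      H j w = ∑' n : ℕ,
        ((ascPochhammer ℝ n).eval (1 + (j : ℝ)) * (ascPochhammer ℝ n).eval (γ + j) /
          ((ascPochhammer ℝ n).eval (1 + γ + j) * (Nat.factorial n))) * w ^ n)
    (k : ℕ) (hk : 1 ≤ k) :
    ∃ ε > (0:ℝ), ∀ z : ℝ, |z| < ε →
      |c * ξ z| < 1 ∧
      iteratedDeriv k h z =
        (Nat.factorial k : ℝ) *
          ∑ j ∈ Finset.Icc 1 k,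
            (Nat.choose (k - 1) (j - 1) : ℝ) * (γ / (γ + j)) * ((q - 1) * c) ^ j /
              (1 - z) ^ (j + k) * H j (c * ξ z) := by
  have hξ' : ξ = fun z => (q - z) / (1 - z) := funext hξ
  subst hξ'
  have hcont : ContinuousAt (fun z : ℝ => |c * ((q - z) / (1 - z))|) 0 := by
    have : (1:ℝ) - 0 ≠ 0 := by norm_num
    fun_prop (disch := assumption)
  have h0 : |c * ((q - 0) / (1 - 0))| < 1 := by
    rw [sub_zero, sub_zero, div_one, abs_of_nonneg (by positivity)]
    nlinarith
  have ev1 := hcont.eventually_lt continuousAt_const h0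
  have ev2 : ∀ᶠ z : ℝ in nhds 0, z < 1 := eventually_lt_nhds one_pos
  obtain ⟨ε, hε, hb⟩ := Metric.eventually_nhds_iff_ball.1 (ev1.and ev2)
  refine ⟨ε, hε, fun z hz => ?_⟩
  have hzU : z ∈ Metric.ball (0:ℝ) ε := by simpa using hz
  refine ⟨(hb z hzU).1, ?_⟩
  obtain ⟨m, rfl⟩ : ∃ m, k = m + 1 := ⟨k - 1, by omega⟩
  rw [aux_main γ q c hγ (Metric.ball 0 ε) Metric.isOpen_ball (fun y hy => (hb y hy).2)
    (fun y hy => (hb y hy).1) h (fun y => by rw [hh, auxG]; simp) m z hzU]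
  congr 1
  have hI : Finset.Icc 1 (m+1) = Finset.Ico (0+1) (m+1+1) := by
    ext x; simp only [Finset.mem_Icc, Finset.mem_Ico]; omega
  rw [hI, ← Finset.sum_Ico_add', Finset.range_eq_Ico]
  refine Finset.sum_congr rfl fun i _ => ?_
  have hGH : auxG γ (i+1) (c * ((q - z) / (1 - z)))
      = γ / (γ + ((i+1 : ℕ) : ℝ)) * H (i+1) (c * ((q - z) / (1 - z))) := by
    rw [hH (i+1) (by omega) _ (hb z hzU).1, auxG, ← tsum_mul_left]
    refine tsum_congr fun n => ?_
    rw [← mul_assoc, coef_eq γ hγ (i+1) n]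
  rw [hGH, Nat.add_sub_cancel, Nat.add_sub_cancel, show i + 1 + (m+1) = i + m + 2 by ring]
  ring
end

section
/- Let γ > 0, q ∈ [0,1) and θ > 0 be reals, and define Λ(z) = −θ ∑_{k=0}^∞ ξ(z)^k/(γ+k) with ξ(z) = (q−z)/(1−z), which is analytic in a neighborhood of z = 0. Then Λ(0) = −θ ∑_{m=0}^∞ q^m/(γ+m), and for every integer j ≥ 1 the j-th Taylor coefficient of Λ at 0 equals θ · ((j−1)!/(1+γ)_j) · ∑_{m=0}^∞ ((j)_m (γ)_m / ((1+γ+j)_m · m!)) q^m. -/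
namespace LPSM

/-- Recursive coefficients. -/
noncomputable def A (γ θ : ℝ) : ℕ → ℕ → ℝ
  | 0, m => -θ / (γ + m)
  | j + 1, m => (j + m) * A γ θ j m - (m + 1) * A γ θ j (m + 1)

lemma poch_shift (x : ℝ) (m : ℕ) :
    x * (ascPochhammer ℝ m).eval (x + 1) = (ascPochhammer ℝ m).eval x * (x + m) := by
  rw [← ascPochhammer_succ_eval, ascPochhammer_succ_left]
  simp

lemma closed_form (γ θ : ℝ) (hγ : 0 < γ) (j m : ℕ) :
    A γ θ (j + 1) m = θ * (((j + 1).factorial : ℝ) * (j.factorial : ℝ) /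
      (ascPochhammer ℝ (j + 1)).eval (1 + γ)) *
      ((ascPochhammer ℝ m).eval ((j : ℝ) + 1) * (ascPochhammer ℝ m).eval γ /
              ((ascPochhammer ℝ m).eval (1 + γ + (j + 1)) * (Nat.factorial m))) := by
  induction j generalizing m with
  | zero =>
    have h1 := poch_shift γ m
    have h2 := poch_shift (1 + γ) m
    have h3 : (ascPochhammer ℝ m).eval (1 : ℝ) = m.factorial := by simp
    have hp : 0 < (ascPochhammer ℝ m).eval γ := ascPochhammer_pos m γ hγ
    have hp1 : 0 < (ascPochhammer ℝ m).eval (1 + γ + 1) := ascPochhammer_pos m _ (by positivity)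
    have hm : (0 : ℝ) < m.factorial := by positivity
    rw [add_comm γ 1] at h1
    have e1 : (ascPochhammer ℝ m).eval γ = γ * (ascPochhammer ℝ m).eval (1 + γ) / (γ + m) := by
      field_simp; linarith
    have e2 : (ascPochhammer ℝ m).eval (1 + γ) =
        (1 + γ) * (ascPochhammer ℝ m).eval (1 + γ + 1) / (1 + γ + m) := by
      field_simp; linarith
    simp only [A, Nat.cast_zero, zero_add, h3, e1, e2, Nat.factorial, ascPochhammer_one,
      Polynomial.eval_X]
    push_cast
    field_simp
    ring
  | succ j ih =>
    rw [A, ih, ih]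
    have h1 := poch_shift ((j : ℝ) + 1) m
    have h2 := poch_shift (1 + γ + (j + 1)) m
    have hp : 0 < (ascPochhammer ℝ m).eval γ := ascPochhammer_pos m γ hγ
    have hp1 : 0 < (ascPochhammer ℝ m).eval (1 + γ + (j + 1)) :=
      ascPochhammer_pos m _ (by positivity)
    have hp2 : 0 < (ascPochhammer ℝ m).eval (1 + γ + (j + 1) + 1) :=
      ascPochhammer_pos m _ (by positivity)
    have hp3 : 0 < (ascPochhammer ℝ (j + 1)).eval (1 + γ) :=
      ascPochhammer_pos _ _ (by positivity)
    have hm : (0 : ℝ) < m.factorial := by positivity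
    have e1 : (ascPochhammer ℝ m).eval ((j : ℝ) + 1 + 1) =
      (ascPochhammer ℝ m).eval ((j : ℝ) + 1) * (j + 1 + m) / (j + 1) := by
      field_simp; linarith
    have e2 : (ascPochhammer ℝ m).eval (1 + γ + ((j : ℝ) + 1)) =
      (1 + γ + (j + 1)) * (ascPochhammer ℝ m).eval (1 + γ + (j + 1) + 1) / (1 + γ + (j + 1) + m) := by
      field_simp; linarith
    rw [ascPochhammer_succ_eval (j + 1)]
    simp only [ascPochhammer_succ_eval m, Nat.factorial_succ m, Nat.factorial_succ (j + 1)]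
    push_cast
    rw [show (1 + γ + ((j : ℝ) + 1 + 1)) = 1 + γ + (j + 1) + 1 by ring, e1, e2,
      Nat.factorial_succ j]
    push_cast
    generalize (ascPochhammer ℝ m).eval (1 + γ + ((j : ℝ) + 1) + 1) = Z at *
    field_simp
    ring

lemma A_bdd (γ θ : ℝ) (hγ : 0 < γ) (j : ℕ) : ∃ C, ∀ m, |A γ θ j m| ≤ C ∧
    m * |A γ θ j m| ≤ C := by
  induction j with
  | zero =>
    refine ⟨|θ| / γ + |θ|, fun m => ?_⟩
    have h : |A γ θ 0 m| = |θ| / (γ + m) := by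
      rw [A, abs_div, abs_neg, abs_of_pos (show 0 < γ + m by positivity)]
    have h0 : 0 ≤ |θ| := abs_nonneg θ
    rw [h]
    constructor
    · have : |θ| / (γ + m) ≤ |θ| / γ := by
        gcongr
        simp
      linarith
    · have h1 : (m : ℝ) * (|θ| / (γ + m)) ≤ |θ| := by
        rw [mul_div_assoc', div_le_iff₀ (by positivity)]
        nlinarith
      have : 0 ≤ |θ| / γ := by positivity
      linarith
  | succ j ih =>
    obtain ⟨C, hC⟩ := ih
    have hstep : ∀ m, |A γ θ (j + 1) m| ≤ (j + 1) * |A γ θ j m| := by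
      intro m
      obtain ⟨c, hc, hc0, hc1⟩ : ∃ c : ℝ, A γ θ (j + 1) m = c * A γ θ j m ∧ -(j + 1) ≤ c ∧
          c ≤ j + 1 := by
        rcases j with _ | j
        · refine ⟨-(γ / (γ + m + 1)), ?_, ?_, ?_⟩
          · simp only [A]
            push_cast
            field_simp
            ring
          · have : γ / (γ + m + 1) ≤ 1 := by
              rw [div_le_one (by positivity)]
              have : (0 : ℝ) ≤ m := by positivity
              linarith
            push_cast
            linarith
          · have : 0 ≤ γ / (γ + m + 1) := by positivity
            push_cast
            linarith
        · refine ⟨(j + 1 + 1) * ((j + 1 + m) / (1 + γ + (j + 1) + m)), ?_, ?_, ?_⟩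
          · rw [A, closed_form γ θ hγ, closed_form γ θ hγ]
            have hp1 : 0 < (ascPochhammer ℝ m).eval (1 + γ + ((j : ℝ) + 1)) :=
              ascPochhammer_pos m _ (by positivity)
            have hp3 : 0 < (ascPochhammer ℝ (j + 1)).eval (1 + γ) :=
              ascPochhammer_pos _ _ (by positivity)
            simp only [ascPochhammer_succ_eval m, Nat.factorial_succ m]
            push_cast
            field_simp
            ring
          · have : 0 ≤ ((j : ℝ) + 1 + 1) * ((j + 1 + m) / (1 + γ + (j + 1) + m)) := by positivity
            have : (0 : ℝ) ≤ j := by positivity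
            push_cast
            linarith
          · push_cast
            apply mul_le_of_le_one_right (by positivity)
            rw [div_le_one (by positivity)]
            linarith
      rw [hc, abs_mul]
      gcongr
      exact abs_le.2 ⟨hc0, hc1⟩
    refine ⟨(j + 1) * C, fun m => ⟨(hstep m).trans ?_, ?_⟩⟩
    · gcongr
      exact (hC m).1
    · calc (m : ℝ) * |A γ θ (j + 1) m| ≤ m * ((j + 1) * |A γ θ j m|) := by
            gcongr
            exact hstep m
        _ = (j + 1) * (m * |A γ θ j m|) := by ring
        _ ≤ (j + 1) * C := by
            gcongr
            exact (hC m).2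

lemma ser_deriv (a : ℕ → ℝ) (C : ℝ) (ha : ∀ m, |a m| ≤ C) (x : ℝ) (hx : |x| < 1) :
    HasDerivAt (fun y => ∑' m : ℕ, a m * y ^ m) (∑' m : ℕ, (m + 1) * a (m + 1) * x ^ m) x := by
  obtain ⟨r, hxr, hr⟩ := exists_between hx
  have hr0 : 0 ≤ r := (abs_nonneg x).trans hxr.le
  have hC : 0 ≤ C := (abs_nonneg _).trans (ha 0)
  have hs : Summable (fun m : ℕ => C * (m * r ^ (m - 1))) := by
    apply Summable.mul_left
    rw [← summable_nat_add_iff 1]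
    have h1 := summable_pow_mul_geometric_of_norm_lt_one (R := ℝ) 1 (r := r)
      (by rwa [Real.norm_eq_abs, abs_of_nonneg hr0])
    have h0 := summable_pow_mul_geometric_of_norm_lt_one (R := ℝ) 0 (r := r)
      (by rwa [Real.norm_eq_abs, abs_of_nonneg hr0])
    refine (h1.add h0).congr fun m => ?_
    simp; ring
  have hb : ∀ (n : ℕ) (y : ℝ), y ∈ Metric.ball (0 : ℝ) r →
      ‖a n * (n * y ^ (n - 1))‖ ≤ C * (n * r ^ (n - 1)) := by
    intro n y hy
    rw [mem_ball_zero_iff, Real.norm_eq_abs] at hy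
    rw [Real.norm_eq_abs, abs_mul, abs_mul, abs_pow, Nat.abs_cast]
    gcongr
    exact ha n
  have hxm : x ∈ Metric.ball (0 : ℝ) r := by simpa using hxr
  have key := hasDerivAt_tsum_of_isPreconnected hs Metric.isOpen_ball
    (convex_ball (0 : ℝ) r).isPreconnected (g := fun n y => a n * y ^ n)
    (g' := fun n y => a n * (n * y ^ (n - 1)))
    (fun n y _ => (hasDerivAt_pow n y).const_mul (a n)) hb (y₀ := 0) (by simpa using (abs_nonneg x).trans_lt hxr)
    (by
      apply summable_of_ne_finset_zero (s := {0})
      intro b hb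
      have : b ≠ 0 := by simpa using hb
      simp [this]) hxm
  have hs' : Summable (fun n : ℕ => a n * (n * x ^ (n - 1))) :=
    Summable.of_norm_bounded hs (fun n => hb n x hxm)
  have e : ∑' n : ℕ, a n * (n * x ^ (n - 1)) = ∑' m : ℕ, ((m : ℝ) + 1) * a (m + 1) * x ^ m := by
    rw [hs'.tsum_eq_zero_add]
    simp
    refine tsum_congr fun m => by ring
  rw [← e]
  exact key

lemma ser_summable (a : ℕ → ℝ) (C : ℝ) (ha : ∀ m, |a m| ≤ C) (x : ℝ) (hx : |x| < 1) :
    Summable (fun m => a m * x ^ m) := by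
  refine Summable.of_norm_bounded ((summable_geometric_of_lt_one (abs_nonneg x) hx).mul_left C) ?_
  intro m
  rw [Real.norm_eq_abs, abs_mul, abs_pow]
  gcongr
  exact ha m

lemma ser_analytic (a : ℕ → ℝ) (C : ℝ) (ha : ∀ m, |a m| ≤ C) (x : ℝ) (hx : |x| < 1) :
    AnalyticAt ℝ (fun y => ∑' m : ℕ, a m * y ^ m) x := by
  set p := FormalMultilinearSeries.ofScalars ℝ a with hp
  have hrad : (1 : NNReal) ≤ p.radius := by
    refine p.le_radius_of_bound C fun n => ?_
    simp only [hp, FormalMultilinearSeries.ofScalars_norm, NNReal.coe_one, one_pow, mul_one]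
    exact ha n
  have h := (p.hasFPowerSeriesOnBall (lt_of_lt_of_le (by simp) hrad)).analyticAt_of_mem
    (y := x) (by
      refine Metric.eball_subset_eball hrad ?_
      simpa [edist_dist, ENNReal.ofReal_lt_one] using hx)
  convert h using 2 with y
  rw [hp]
  rw [← FormalMultilinearSeries.ofScalarsSum, FormalMultilinearSeries.ofScalars_sum_eq]
  simp [smul_eq_mul]

end LPSM

open LPSM in
/-- Taylor coefficients of the LPSM-limit log-generating function
`Λ(z) = −θ ∑ ξ(z)^k/(γ+k)` of the Luria–Delbrück mutant number. -/
theorem lpsm_loggen_taylor_coefficients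
    (γ q θ : ℝ) (hγ : 0 < γ) (hq0 : 0 ≤ q) (hq1 : q < 1) (hθ : 0 < θ)
    (Λ : ℝ → ℝ)
    (hΛ : ∀ z : ℝ, Λ z = -θ * ∑' k : ℕ, ((q - z) / (1 - z)) ^ k / (γ + k)) :
    AnalyticAt ℝ Λ 0 ∧
    Λ 0 = -θ * ∑' m : ℕ, q ^ m / (γ + m) ∧
    ∀ j : ℕ, 1 ≤ j →
      iteratedDeriv j Λ 0 / (Nat.factorial j) =
        θ * ((Nat.factorial (j - 1) : ℝ) / (ascPochhammer ℝ j).eval (1 + γ)) *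
          ∑' m : ℕ,
            ((ascPochhammer ℝ m).eval (j : ℝ) * (ascPochhammer ℝ m).eval γ /
              ((ascPochhammer ℝ m).eval (1 + γ + j) * (Nat.factorial m))) * q ^ m := by
  have hΛ' : Λ = fun z => ∑' m : ℕ, A γ θ 0 m * ((q - z) / (1 - z)) ^ m := by
    funext z
    rw [hΛ, ← tsum_mul_left]
    refine tsum_congr fun m => ?_
    simp only [A]; ring
  refine ⟨?_, by simp [hΛ], ?_⟩
  · obtain ⟨C, hC⟩ := A_bdd γ θ hγ 0
    have h1 : AnalyticAt ℝ (fun z : ℝ => (q - z) / (1 - z)) 0 := by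
      refine (analyticAt_const.sub analyticAt_id).div (analyticAt_const.sub analyticAt_id) (by simp)
    rw [hΛ']
    refine AnalyticAt.fun_comp (g := fun y => ∑' m : ℕ, A γ θ 0 m * y ^ m) ?_ h1
    apply ser_analytic _ C (fun m => (hC m).1)
    simpa [abs_of_nonneg hq0] using hq1
  have main : ∀ j : ℕ, ∀ z : ℝ, z < 1 → |(q - z) / (1 - z)| < 1 →
      iteratedDeriv j Λ z = (1 - z)⁻¹ ^ j * ∑' m : ℕ, A γ θ j m * ((q - z) / (1 - z)) ^ m := by
    intro j
    induction j with
    | zero => intro z _ _; simp [hΛ']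
    | succ j ih =>
      intro z hz hx
      obtain ⟨C, hC⟩ := A_bdd γ θ hγ j
      have hz1 : (1 - z) ≠ 0 := by linarith
      have hξ : HasDerivAt (fun z : ℝ => (q - z) / (1 - z))
          ((-1 * (1 - z) - (q - z) * (-1)) / (1 - z) ^ 2) z :=
        ((hasDerivAt_id z).const_sub q).div ((hasDerivAt_id z).const_sub 1) hz1
      have hP := ser_deriv _ C (fun m => (hC m).1) _ hx
      have hinv : HasDerivAt (fun z : ℝ => (1 - z)⁻¹) (-(-1) / (1 - z) ^ 2) z :=
        ((hasDerivAt_id z).const_sub 1).inv hz1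
      have hD := (hinv.pow j).mul (hP.comp z hξ)
      rw [iteratedDeriv_succ]
      have hev : iteratedDeriv j Λ =ᶠ[nhds z] fun z =>
          (1 - z)⁻¹ ^ j * ∑' m : ℕ, A γ θ j m * ((q - z) / (1 - z)) ^ m := by
        have e2 : ∀ᶠ w in nhds z, |(q - w) / (1 - w)| < 1 :=
          (hξ.continuousAt.abs).eventually_lt continuousAt_const hx
        filter_upwards [e2, eventually_lt_nhds hz] with w hw1 hw2
        exact ih w hw2 hw1
      rw [hev.deriv_eq]
      refine hD.deriv.trans ?_
      have hs := ser_summable _ C (fun m => (hC m).1) _ hx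
      have hsm := ser_summable (fun m => (m : ℝ) * A γ θ j m) C (fun m => by
        rw [abs_mul, Nat.abs_cast]; exact (hC m).2) _ hx
      have hs1 := ser_summable (fun m => ((m : ℝ) + 1) * A γ θ j (m + 1)) C (fun m => by
        rw [abs_mul, abs_of_nonneg (by positivity)]; exact_mod_cast (hC (m + 1)).2) _ hx
      have hξz : (q - z) = ((q - z) / (1 - z)) * (1 - z) := by field_simp
      simp only [Pi.pow_apply, Function.comp]
      generalize hxd : (q - z) / (1 - z) = x at *
      have hx1 : ∑' m : ℕ, A γ θ (j + 1) m * x ^ m = j * ∑' m : ℕ, A γ θ j m * x ^ m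
          - (1 - x) * ∑' m : ℕ, (m + 1) * A γ θ j (m + 1) * x ^ m := by
        have e : x * ∑' m : ℕ, ((m : ℝ) + 1) * A γ θ j (m + 1) * x ^ m =
            ∑' m : ℕ, (m : ℝ) * A γ θ j m * x ^ m := by
          rw [hsm.tsum_eq_zero_add, ← tsum_mul_left]
          simp
          refine tsum_congr fun m => by ring
        have e3 : ∀ m, A γ θ (j + 1) m * x ^ m = j * (A γ θ j m * x ^ m)
          + (m : ℝ) * A γ θ j m * x ^ m - ((m : ℝ) + 1) * A γ θ j (m + 1) * x ^ m := by
          intro m; rw [A]; ring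
        rw [tsum_congr e3, Summable.tsum_sub ((hs.mul_left _).add hsm) hs1,
          Summable.tsum_add (hs.mul_left _) hsm, tsum_mul_left, ← e]
        ring
      rw [hx1, hξz]
      generalize (∑' m : ℕ, A γ θ j m * x ^ m) = P
      generalize (∑' m : ℕ, ((m : ℝ) + 1) * A γ θ j (m + 1) * x ^ m) = Q
      rcases j with _ | j
      · simp; field_simp; ring
      · simp; field_simp; ring
  intro j hj
  rw [main j 0 one_pos (by simpa [abs_of_nonneg hq0] using hq1)]
  obtain ⟨j, rfl⟩ : ∃ k, j = k + 1 := ⟨j - 1, by omega⟩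
  have hp3 : 0 < (ascPochhammer ℝ (j + 1)).eval (1 + γ) :=
      ascPochhammer_pos _ _ (by positivity)
  simp only [closed_form γ θ hγ, sub_zero, inv_one, one_pow, one_mul, div_one, mul_assoc,
    tsum_mul_left]
  rw [Nat.add_sub_cancel]
  have : ((j + 1).factorial : ℝ) ≠ 0 := by positivity
  push_cast
  field_simp
end

section
/- Let α > β ≥ 0 be reals, λ = α − β, δ > 0, γ = δ/λ, q = β/α, θ > 0, and let z be a real with 0 ≤ z < (1+q)/2 (so that |ξ| < 1, ξ = (q−z)/(1−z)). For N > 1 set τ_N = (log N)/δ and ν_N = αθ/N. Then lim_{N→∞} ν_N ∫_0^{τ_N} e^{δs} (φ_{τ_N − s}(z) − 1) ds = −θ ∑_{k=0}^∞ ξ^k/(γ+k), where φ_t(z) = 1 − (1−q)/(1 − ξ e^{−λt}). -/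
open Filter Topology

lemma aux_int (c : ℝ) (hc : 0 < c) :
    MeasureTheory.IntegrableOn (fun u : ℝ => Real.exp (-c * u)) (Set.Ioi 0) ∧
    ∫ u in Set.Ioi (0:ℝ), Real.exp (-c * u) = 1 / c := by
  refine ⟨integrableOn_exp_mul_Ioi (by linarith) 0, ?_⟩
  rw [integral_exp_mul_Ioi (by linarith) 0]
  simp

lemma aux_bound (ξ lam u : ℝ) (hl : 0 < lam) (hu : 0 ≤ u) :
    |ξ * Real.exp (-(lam * u))| ≤ |ξ| := by
  rw [abs_mul, Real.abs_exp]
  have : Real.exp (-(lam * u)) ≤ 1 := Real.exp_le_one_iff.2 (by nlinarith [mul_nonneg hl.le hu])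
  nlinarith [abs_nonneg ξ]

lemma aux_main_s7 (ξ lam δ : ℝ) (hξ : |ξ| < 1) (hl : 0 < lam) (hδ : 0 < δ) :
    MeasureTheory.IntegrableOn
      (fun u : ℝ => Real.exp (-δ * u) * (1 - ξ * Real.exp (-(lam * u)))⁻¹) (Set.Ioi 0) ∧
    ∫ u in Set.Ioi (0:ℝ), Real.exp (-δ * u) * (1 - ξ * Real.exp (-(lam * u)))⁻¹
      = ∑' k : ℕ, ξ ^ k / (δ + lam * k) := by
  have hc : ∀ k : ℕ, 0 < δ + lam * k := fun k => by positivity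
  constructor
  · refine MeasureTheory.Integrable.mul_bdd (c := (1 - |ξ|)⁻¹) (aux_int δ hδ).1 ?_ ?_
    · exact (by fun_prop : Measurable _).aestronglyMeasurable
    · filter_upwards [MeasureTheory.ae_restrict_mem measurableSet_Ioi] with u hu
      have h := aux_bound ξ lam u hl (le_of_lt hu)
      have h2 := le_abs_self (ξ * Real.exp (-(lam * u)))
      rw [Real.norm_eq_abs, abs_inv]
      apply inv_anti₀ (by linarith)
      exact le_trans (by linarith) (le_abs_self _)
  · have hs : Summable fun k : ℕ => ∫ u in Set.Ioi (0:ℝ),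
        ‖ξ ^ k * Real.exp (-(δ + lam * k) * u)‖ := by
      have he : ∀ k : ℕ, ∫ u in Set.Ioi (0:ℝ), ‖ξ ^ k * Real.exp (-(δ + lam * k) * u)‖
          = |ξ| ^ k * (1 / (δ + lam * k)) := by
        intro k
        simp_rw [Real.norm_eq_abs, abs_mul, Real.abs_exp, abs_pow]
        rw [MeasureTheory.integral_const_mul, (aux_int _ (hc k)).2]
      simp_rw [he]
      refine Summable.of_nonneg_of_le (fun k => by have := hc k; positivity) (fun k => ?_)
        ((summable_geometric_of_lt_one (abs_nonneg ξ) hξ).mul_right (1 / δ))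
      apply mul_le_mul_of_nonneg_left _ (by positivity)
      apply one_div_le_one_div_of_le hδ
      have : 0 ≤ lam * (k:ℝ) := by positivity
      linarith
    have key := MeasureTheory.hasSum_integral_of_summable_integral_norm
      (μ := MeasureTheory.volume.restrict (Set.Ioi (0:ℝ)))
      (F := fun (k : ℕ) (u : ℝ) => ξ ^ k * Real.exp (-(δ + lam * k) * u))
      (fun k => (aux_int _ (hc k)).1.const_mul _) hs
    have h1 : ∀ k : ℕ, ∫ u in Set.Ioi (0:ℝ), ξ ^ k * Real.exp (-(δ + lam * k) * u)
        = ξ ^ k / (δ + lam * k) := by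
      intro k
      rw [MeasureTheory.integral_const_mul, (aux_int _ (hc k)).2, mul_one_div]
    simp_rw [h1] at key
    rw [key.tsum_eq]
    apply MeasureTheory.setIntegral_congr_fun measurableSet_Ioi
    intro u hu
    have h := aux_bound ξ lam u hl (le_of_lt hu)
    have hg := (hasSum_geometric_of_norm_lt_one (ξ := ξ * Real.exp (-(lam * u)))
      (by rw [Real.norm_eq_abs]; linarith)).mul_left (Real.exp (-δ * u))
    simp only
    rw [← hg.tsum_eq]
    refine tsum_congr fun k => ?_
    rw [mul_pow, ← Real.exp_nat_mul, mul_left_comm, ← Real.exp_add]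
    congr 2
    ring

/-- Large population–small mutation (LPSM) limit of the Luria–Delbrück log-generating
function with `θ = Nμ` held constant. -/
theorem lpsm_limit_of_loggen
    (α β δ θ z lam γ q ξ : ℝ)
    (hβ : 0 ≤ β) (hαβ : β < α) (hδ : 0 < δ) (hθ : 0 < θ)
    (hlam : lam = α - β) (hγ : γ = δ / lam) (hq : q = β / α)
    (hz0 : 0 ≤ z) (hz1 : z < (1 + q) / 2)
    (hξ : ξ = (q - z) / (1 - z)) :
    Tendsto
      (fun N : ℝ =>
        (α * θ / N) *
          ∫ s in (0:ℝ)..(Real.log N / δ),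
            Real.exp (δ * s) *
              ((1 - (1 - q) /
                  (1 - ξ * Real.exp (-(lam * (Real.log N / δ - s))))) - 1))
      atTop (nhds (-θ * ∑' k : ℕ, ξ ^ k / (γ + k))) := by
  have hα : 0 < α := by linarith
  have hl : 0 < lam := by linarith
  have hq1 : q < 1 := by rw [hq, div_lt_one hα]; exact hαβ
  have hx : |ξ| < 1 := by
    have : 0 < 1 - z := by linarith
    rw [hξ, abs_div, abs_of_pos this, div_lt_one this, abs_lt]
    constructor <;> linarith
  have hαq : α * (1 - q) = lam := by rw [hq, hlam]; field_simp
  obtain ⟨hI, hV⟩ := aux_main_s7 ξ lam δ hx hl hδ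
  have hT : Tendsto (fun N : ℝ => Real.log N / δ) atTop atTop :=
    Real.tendsto_log_atTop.atTop_div_const hδ
  have hlim := (MeasureTheory.intervalIntegral_tendsto_integral_Ioi 0 hI hT).const_mul (-θ * lam)
  have hval : -θ * ∑' k : ℕ, ξ ^ k / (γ + k)
      = -θ * lam * ∑' k : ℕ, ξ ^ k / (δ + lam * k) := by
    rw [mul_assoc, ← tsum_mul_left (a := lam)]
    congr 1
    refine tsum_congr fun k => ?_
    have : 0 < δ + lam * k := by positivity
    have h2 : γ + k = (δ + lam * k) / lam := by rw [hγ]; field_simp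
    rw [h2]
    field_simp
  rw [hval, ← hV]
  refine hlim.congr' ?_
  filter_upwards [eventually_gt_atTop 0] with N hN
  have hsub := intervalIntegral.integral_comp_sub_left (a := 0) (b := Real.log N / δ)
    (fun u : ℝ => Real.exp (-δ * u) * (1 - ξ * Real.exp (-(lam * u)))⁻¹) (Real.log N / δ)
  rw [sub_self, sub_zero] at hsub
  rw [← hsub, ← intervalIntegral.integral_const_mul, ← intervalIntegral.integral_const_mul]
  congr 1
  funext s
  have hE : Real.exp (-δ * (Real.log N / δ - s)) = Real.exp (δ * s) / N := by
    have : -δ * (Real.log N / δ - s) = δ * s - Real.log N := by field_simp; ring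
    rw [this, Real.exp_sub, Real.exp_log hN]
  rw [hE, ← hαq, div_eq_mul_inv (1 - q)]
  ring
end

section
/- Let δ > 0, λ > 0 be reals, γ = δ/λ, and let ξ be a real with |ξ| < 1. Then (1/γ) ∫_0^∞ δ e^{−δt} / (ξ e^{−λt} − 1) dt = −∑_{k=0}^∞ ξ^k/(γ+k). -/
/-- The LPSM-limit series as an exponential-age integral:
`(1/γ)∫_0^∞ δe^{−δt}/(ξe^{−λt} − 1) dt = −∑_{k≥0} ξ^k/(γ+k)`. -/
theorem exponential_age_integral_eq_series
    (δ lam γ ξ : ℝ) (hδ : 0 < δ) (hlam : 0 < lam) (hγ : γ = δ / lam) (hξ : |ξ| < 1) :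
    (1 / γ) * ∫ t in Set.Ioi (0:ℝ),
        δ * Real.exp (-(δ * t)) / (ξ * Real.exp (-(lam * t)) - 1)
      = -∑' k : ℕ, ξ ^ k / (γ + k) := by
  have hpos : ∀ k : ℕ, 0 < δ + k * lam := fun k => by positivity
  have hint : ∀ c : ℝ, ∀ k : ℕ, ∫ t in Set.Ioi (0:ℝ), c * Real.exp (-(δ + k * lam) * t)
      = c / (δ + k * lam) := by
    intro c k
    rw [MeasureTheory.integral_const_mul, integral_exp_mul_Ioi (by linarith [hpos k])]
    have := (hpos k).ne'
    rw [mul_zero, Real.exp_zero, neg_div_neg_eq, mul_one_div]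
  have key := MeasureTheory.hasSum_integral_of_summable_integral_norm
    (μ := MeasureTheory.volume.restrict (Set.Ioi (0:ℝ)))
    (F := fun (k : ℕ) (t : ℝ) => (-(δ * ξ ^ k)) * Real.exp (-(δ + k * lam) * t))
    (fun k => (integrableOn_exp_mul_Ioi (by linarith [hpos k]) 0).const_mul _)
    (by
      simp only [norm_mul, Real.norm_eq_abs, Real.abs_exp, hint]
      refine Summable.of_nonneg_of_le (fun k => by have := hpos k; positivity) (fun k => ?_)
        (summable_geometric_of_lt_one (abs_nonneg ξ) hξ)
      rw [div_le_iff₀ (hpos k), abs_neg, abs_mul, abs_of_pos hδ, abs_pow]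
      have : 0 ≤ |ξ| ^ k * (k * lam) := by positivity
      linarith)
  simp only [hint] at key
  have hI : ∫ t in Set.Ioi (0:ℝ),
        δ * Real.exp (-(δ * t)) / (ξ * Real.exp (-(lam * t)) - 1) =
      ∫ t in Set.Ioi (0:ℝ), ∑' k : ℕ, (-(δ * ξ ^ k)) * Real.exp (-(δ + k * lam) * t) := by
    refine MeasureTheory.setIntegral_congr_fun measurableSet_Ioi (fun t ht => ?_)
    have ht : 0 < t := ht
    have hx : |ξ * Real.exp (-(lam * t))| < 1 := by
      rw [abs_mul, Real.abs_exp]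
      have : Real.exp (-(lam * t)) ≤ 1 := Real.exp_le_one_iff.2 (by nlinarith [mul_pos hlam ht])
      nlinarith [abs_nonneg ξ, Real.exp_pos (-(lam * t))]
    have e : ∀ k : ℕ, (-(δ * ξ ^ k)) * Real.exp (-(δ + k * lam) * t)
        = (-(δ * Real.exp (-(δ * t)))) * (ξ * Real.exp (-(lam * t))) ^ k := by
      intro k
      rw [mul_pow, ← Real.exp_nat_mul,
        show -(δ + k * lam) * t = -(δ * t) + k * (-(lam * t)) by ring, Real.exp_add]
      ring
    simp only [e]
    rw [tsum_mul_left, tsum_geometric_of_abs_lt_one hx, ← div_eq_mul_inv,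
      ← neg_sub 1 (ξ * _), div_neg, neg_div]
  rw [hI, ← key.tsum_eq, ← tsum_mul_left, ← tsum_neg]
  refine tsum_congr (fun k => ?_)
  have h1 := (hpos k).ne'
  have h2 : γ + k = (δ + k * lam) / lam := by rw [hγ]; field_simp
  rw [h2, hγ]
  field_simp
end

section
/- For every real q ∈ [0,1), lim_{γ→∞} [ (1+γ) / F(γ) − ((1−q)γ + 1 + q) ] = 0, where F(γ) = ∑_{k=0}^∞ γ(γ+1) q^k / ((γ+k)(γ+k+1)). -/
open Filter Topology

lemma aux_ratio (a : ℝ) : Tendsto (fun γ : ℝ => γ / (γ + a)) atTop (nhds 1) := by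
  have h : Tendsto (fun γ : ℝ => 1 - a / (γ + a)) atTop (nhds (1 - 0)) :=
    tendsto_const_nhds.sub
      (tendsto_const_nhds.div_atTop (tendsto_atTop_add_const_right _ a tendsto_id))
  rw [sub_zero] at h
  refine h.congr' ?_
  filter_upwards [eventually_gt_atTop (-a)] with γ hγ
  have : γ + a ≠ 0 := by linarith
  field_simp
  ring

lemma aux_G (q : ℝ) (hq0 : 0 ≤ q) (hq1 : q < 1) :
    Tendsto (fun γ : ℝ => ∑' k : ℕ,
        q ^ k * (k * (γ / (γ + k)) * (1 + γ / (γ + (k + 1)))))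
      atTop (nhds (2 * (q / (1 - q) ^ 2))) := by
  have hn : ‖q‖ < 1 := by rwa [Real.norm_of_nonneg hq0]
  have hs := hasSum_coe_mul_geometric_of_norm_lt_one hn
  rw [← (hs.mul_left 2).tsum_eq]
  refine tendsto_tsum_of_dominated_convergence (hs.mul_left 2).summable ?_ ?_
  · intro k
    have h := ((((aux_ratio k).const_mul (k : ℝ)).mul
      ((aux_ratio (k + 1)).const_add 1)).const_mul (q ^ k))
    convert h using 2
    ring
  · filter_upwards [eventually_gt_atTop 0] with γ hγ k
    have h1 : γ / (γ + k) ≤ 1 := by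
      rw [div_le_one (by positivity)]; have : (0:ℝ) ≤ k := by positivity
      linarith
    have h2 : γ / (γ + (k + 1)) ≤ 1 := by
      rw [div_le_one (by positivity)]; have : (0:ℝ) ≤ k := by positivity
      linarith
    rw [Real.norm_of_nonneg (by positivity)]
    calc q ^ k * (k * (γ / (γ + k)) * (1 + γ / (γ + (k + 1))))
        ≤ q ^ k * (k * 1 * (1 + 1)) := by gcongr
      _ = _ := by ring

lemma aux_F (q : ℝ) (hq0 : 0 ≤ q) (hq1 : q < 1) (γ : ℝ) (hγ : 0 < γ) :
    (∑' k : ℕ, γ * (γ + 1) * q ^ k / ((γ + k) * (γ + k + 1))) = (1 - q)⁻¹ -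
      (∑' k : ℕ, q ^ k * (k * (γ / (γ + k)) * (1 + γ / (γ + (k + 1))))) / γ := by
  have hn : ‖q‖ < 1 := by rwa [Real.norm_of_nonneg hq0]
  have hs := hasSum_coe_mul_geometric_of_norm_lt_one hn
  have hS : Summable fun k : ℕ => q ^ k * (k * (γ / (γ + k)) * (1 + γ / (γ + (k + 1)))) := by
    refine Summable.of_nonneg_of_le (fun k => by positivity) (fun k => ?_)
      (hs.mul_left 2).summable
    have h1 : γ / (γ + k) ≤ 1 := by
      rw [div_le_one (by positivity)]; have : (0:ℝ) ≤ k := by positivity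
      linarith
    have h2 : γ / (γ + (k + 1)) ≤ 1 := by
      rw [div_le_one (by positivity)]; have : (0:ℝ) ≤ k := by positivity
      linarith
    calc q ^ k * (k * (γ / (γ + k)) * (1 + γ / (γ + (k + 1))))
        ≤ q ^ k * (k * 1 * (1 + 1)) := by gcongr
      _ = _ := by ring
  have := (hasSum_geometric_of_lt_one hq0 hq1).sub (hS.hasSum.div_const γ)
  rw [← this.tsum_eq]
  refine tsum_congr fun k => ?_
  have h1 : γ + k ≠ 0 := by positivity
  have h2 : γ + k + 1 ≠ 0 := by positivity
  rw [← add_assoc]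
  field_simp
  ring

/-- Large-γ linear asymptotics of the boundary `θ = (1+γ)·₂F₁(1,γ;2+γ;q)⁻¹` between the
regions where zero mutants is, or is not, the most probable outcome. -/
theorem mode_boundary_large_gamma_asymptotics
    (q : ℝ) (hq0 : 0 ≤ q) (hq1 : q < 1) :
    Tendsto
      (fun γ : ℝ =>
        (1 + γ) / (∑' k : ℕ, γ * (γ + 1) * q ^ k / ((γ + k) * (γ + k + 1)))
          - ((1 - q) * γ + 1 + q))
      atTop (nhds 0) := by
  have hq : 1 - q ≠ 0 := by linarith
  have hG := aux_G q hq0 hq1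
  obtain ⟨G, hGd⟩ : ∃ G : ℝ → ℝ, G = (fun γ : ℝ => ∑' k : ℕ,
    q ^ k * (k * (γ / (γ + k)) * (1 + γ / (γ + (k + 1))))) := ⟨_, rfl⟩
  rw [← hGd] at hG
  have hF : ∀ γ : ℝ, 0 < γ →
      (∑' k : ℕ, γ * (γ + 1) * q ^ k / ((γ + k) * (γ + k + 1))) = (1 - q)⁻¹ - G γ / γ := by
    intro γ hγ
    rw [hGd]
    exact aux_F q hq0 hq1 γ hγ
  have hGg : Tendsto (fun γ => G γ / γ) atTop (nhds 0) := hG.div_atTop tendsto_id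
  have hD : Tendsto (fun γ => (1 - q)⁻¹ - G γ / γ) atTop (nhds ((1 - q)⁻¹ - 0)) :=
    tendsto_const_nhds.sub hGg
  have hD0 : (1 - q)⁻¹ - 0 ≠ 0 := by simpa using hq
  have hN : Tendsto (fun γ => 1 - (1 - q)⁻¹ * (1 + q) + (1 - q) * G γ + (1 + q) * (G γ / γ))
      atTop (nhds (1 - (1 - q)⁻¹ * (1 + q) + (1 - q) * (2 * (q / (1 - q) ^ 2)) + (1 + q) * 0)) :=
    ((hG.const_mul _).const_add _).add (hGg.const_mul _)
  have hR := hN.div hD hD0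
  have hz : (1 - (1 - q)⁻¹ * (1 + q) + (1 - q) * (2 * (q / (1 - q) ^ 2)) + (1 + q) * 0)
      / ((1 - q)⁻¹ - 0) = 0 := by
    field_simp
    ring
  rw [hz] at hR
  refine hR.congr' ?_
  filter_upwards [eventually_gt_atTop 0, hD.eventually_ne hD0] with γ hγ hne
  rw [hF γ hγ]
  simp only [Pi.div_apply]
  rw [div_eq_iff hne, sub_mul (_ / _), div_mul_cancel₀ _ hne]
  have := hγ.ne'
  field_simp
  ring
end

section
/- Let γ > 2, q ∈ [0,1) and s > 0 be reals. For θ > 1 define a(θ) = (1/(1−q)) · √(θ(γ − q(γ−2))/((γ−1)(γ−2))), b(θ) = θ/((1−q)(γ−1)a(θ)), y(θ) = (e^{−s/a(θ)} − q)/(1−q), and Λ(θ) = −(θ/γ)(1 − y(θ)) ∑_{k=0}^∞ (k!/(1+γ)_k) y(θ)^k. Then lim_{θ→∞} [Λ(θ) + b(θ)·s] = s²/2. -/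
open Filter Topology

noncomputable def cc (γ : ℝ) (k : ℕ) : ℝ :=
  (Nat.factorial k : ℝ) / (ascPochhammer ℝ k).eval (1 + γ)

lemma cc_pos (γ : ℝ) (hγ : 2 < γ) (k : ℕ) : 0 < cc γ k := by
  unfold cc
  have := ascPochhammer_pos k (1 + γ) (by linarith)
  positivity

lemma cc_succ (γ : ℝ) (hγ : 2 < γ) (k : ℕ) :
    cc γ (k + 1) * (k + 1 + γ) = cc γ k * (k + 1) := by
  unfold cc
  have h := ascPochhammer_pos k (1 + γ) (by linarith)
  rw [ascPochhammer_succ_eval, Nat.factorial_succ]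
  have h2 : (0 : ℝ) < 1 + γ + k := by positivity
  push_cast
  field_simp
  ring

lemma cc_gamma (γ : ℝ) (hγ : 2 < γ) (k : ℕ) (hk : 0 < k) :
    cc γ k = γ * (Real.GammaSeq γ k * (k : ℝ) ^ (-γ)) := by
  have hk' : (0 : ℝ) < k := by exact_mod_cast hk
  have key : ∀ n : ℕ, ∏ j ∈ Finset.range (n + 1), (γ + j)
      = γ * (ascPochhammer ℝ n).eval (1 + γ) := by
    intro n
    induction n with
    | zero => simp
    | succ m ih =>
      rw [Finset.prod_range_succ, ih, ascPochhammer_succ_eval]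
      push_cast
      ring
  have h := ascPochhammer_pos k (1 + γ) (by linarith)
  unfold cc Real.GammaSeq
  rw [key, Real.rpow_neg hk'.le]
  have : (0 : ℝ) < (k : ℝ) ^ γ := Real.rpow_pos_of_pos hk' _
  field_simp

lemma cc_lim2 (γ : ℝ) (hγ : 2 < γ) :
    Tendsto (fun k : ℕ => cc γ k * (k : ℝ) ^ 2) atTop (𝓝 0) := by
  have h1 := Real.GammaSeq_tendsto_Gamma γ
  have h2 : Tendsto (fun k : ℕ => (k : ℝ) ^ (-(γ - 2))) atTop (𝓝 0) :=
    (tendsto_rpow_neg_atTop (by linarith)).comp tendsto_natCast_atTop_atTop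
  have h3 := (h1.mul h2).const_mul γ
  simp only [mul_zero] at h3
  refine h3.congr' ?_
  filter_upwards [eventually_gt_atTop 0] with k hk
  have hk' : (0 : ℝ) < k := by exact_mod_cast hk
  rw [cc_gamma γ hγ k hk]
  have : (k : ℝ) ^ (-(γ - 2)) = (k : ℝ) ^ (-γ) * (k : ℝ) ^ 2 := by
    rw [← Real.rpow_natCast, ← Real.rpow_add hk']
    congr 1
    push_cast
    ring
  rw [this]
  ring

lemma cc_lim (γ α β : ℝ) (hγ : 2 < γ) :
    Tendsto (fun k : ℕ => ((k : ℝ) + γ) * (α * k + β) * cc γ k) atTop (𝓝 0) := by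
  have h0 : Tendsto (fun k : ℕ => ((k : ℝ))⁻¹) atTop (𝓝 0) :=
    tendsto_inv_atTop_nhds_zero_nat
  have h1 := (cc_lim2 γ hγ).mul (((h0.const_mul γ).const_add 1).mul ((h0.const_mul β).const_add α))
  simp only [zero_mul] at h1
  refine h1.congr' ?_
  filter_upwards [eventually_gt_atTop 0] with k hk
  have hk' : (0 : ℝ) < k := by exact_mod_cast hk
  field_simp

lemma cc_tele (f u : ℕ → ℝ) (hf : ∀ k, 0 ≤ f k) (h : ∀ k, u k - u (k + 1) = f k)
    (hu : Tendsto u atTop (𝓝 0)) : HasSum f (u 0) := by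
  rw [hasSum_iff_tendsto_nat_of_nonneg hf]
  have : ∀ n, ∑ i ∈ Finset.range n, f i = u 0 - u n := by
    intro n
    rw [← Finset.sum_range_sub' u n]
    exact Finset.sum_congr rfl fun i _ => (h i).symm
  simp only [this]
  simpa using hu.const_sub (u 0)

lemma cc_sum0 (γ : ℝ) (hγ : 2 < γ) : HasSum (cc γ) (γ / (γ - 1)) := by
  have h1 : γ - 1 ≠ 0 := by linarith
  have := cc_tele (cc γ) (fun k : ℕ => ((k : ℝ) + γ) * (0 * k + 1 / (γ - 1)) * cc γ k)
    (fun k => (cc_pos γ hγ k).le) ?_ (cc_lim γ 0 (1 / (γ - 1)) hγ)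
  · convert this using 1
    simp [cc]
    field_simp
  · intro k
    have e := cc_succ γ hγ k
    push_cast
    field_simp
    linear_combination -e

lemma cc_sum1 (γ : ℝ) (hγ : 2 < γ) :
    HasSum (fun k : ℕ => cc γ k * k) (γ / ((γ - 1) * (γ - 2))) := by
  have h1 : γ - 1 ≠ 0 := by linarith
  have h2 : γ - 2 ≠ 0 := by linarith
  have := cc_tele (fun k : ℕ => cc γ k * k)
    (fun k : ℕ => ((k : ℝ) + γ) * (1 / (γ - 2) * k + 1 / ((γ - 1) * (γ - 2))) * cc γ k)
    (fun k => mul_nonneg (cc_pos γ hγ k).le (Nat.cast_nonneg k)) ?_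
    (cc_lim γ (1 / (γ - 2)) (1 / ((γ - 1) * (γ - 2))) hγ)
  · convert this using 1
    simp [cc]
    field_simp
  · intro k
    have e := cc_succ γ hγ k
    push_cast
    field_simp
    linear_combination (-((γ - 1) * (k + 1) + 1)) * e

noncomputable def GG (γ y : ℝ) : ℝ := ∑' k : ℕ, cc γ k * ∑ i ∈ Finset.range k, y ^ i

lemma geo_bd (y : ℝ) (h0 : 0 ≤ y) (h1 : y ≤ 1) (k : ℕ) :
    ∑ i ∈ Finset.range k, y ^ i ≤ k := by
  calc _ ≤ ∑ i ∈ Finset.range k, (1 : ℝ) := Finset.sum_le_sum fun i _ => pow_le_one₀ h0 h1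
    _ = k := by simp

lemma GG_norm (γ y : ℝ) (hγ : 2 < γ) (h0 : 0 ≤ y) (h1 : y ≤ 1) (k : ℕ) :
    ‖cc γ k * ∑ i ∈ Finset.range k, y ^ i‖ ≤ cc γ k * k := by
  have hc := (cc_pos γ hγ k).le
  have : 0 ≤ ∑ i ∈ Finset.range k, y ^ i := Finset.sum_nonneg fun i _ => pow_nonneg h0 i
  rw [Real.norm_of_nonneg (mul_nonneg hc this)]
  exact mul_le_mul_of_nonneg_left (geo_bd y h0 h1 k) hc

lemma F_eq (γ y : ℝ) (hγ : 2 < γ) (h0 : 0 ≤ y) (h1 : y ≤ 1) :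
    ∑' k : ℕ, cc γ k * y ^ k = γ / (γ - 1) - (1 - y) * GG γ y := by
  have hs : Summable (fun k : ℕ => cc γ k * ∑ i ∈ Finset.range k, y ^ i) :=
    Summable.of_norm_bounded (cc_sum1 γ hγ).summable (GG_norm γ y hγ h0 h1)
  have := (cc_sum0 γ hγ).sub (hs.hasSum.mul_left (1 - y))
  rw [← GG] at this
  rw [← this.tsum_eq]
  congr 1
  ext k
  have := mul_neg_geom_sum y k
  linear_combination (cc γ k) * this

lemma GG_lim (γ : ℝ) (hγ : 2 < γ) {l : Filter ℝ} (y : ℝ → ℝ) (hy : Tendsto y l (𝓝 1))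
    (hb : ∀ᶠ x in l, 0 ≤ y x ∧ y x ≤ 1) :
    Tendsto (fun x => GG γ (y x)) l (𝓝 (γ / ((γ - 1) * (γ - 2)))) := by
  rw [← (cc_sum1 γ hγ).tsum_eq]
  unfold GG
  refine tendsto_tsum_of_dominated_convergence (cc_sum1 γ hγ).summable ?_ ?_
  · intro k
    have : Tendsto (fun x => cc γ k * ∑ i ∈ Finset.range k, y x ^ i) l
        (𝓝 (cc γ k * ∑ i ∈ Finset.range k, (1 : ℝ) ^ i)) :=
      (tendsto_finsetSum _ fun i _ => hy.pow i).const_mul _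
    simpa using this
  · filter_upwards [hb] with x hx k
    exact GG_norm γ _ hγ hx.1 hx.2 k

lemma exp_lim : Tendsto (fun e : ℝ => (Real.exp (-e) - 1 + e) / e ^ 2) (𝓝[>] 0) (𝓝 (1 / 2)) := by
  rw [tendsto_iff_norm_sub_tendsto_zero]
  have h0 : Tendsto (fun e : ℝ => e) (𝓝[>] (0 : ℝ)) (𝓝 0) := tendsto_id.mono_left nhdsWithin_le_nhds
  refine squeeze_zero' (Eventually.of_forall fun _ => norm_nonneg _) ?_ h0
  filter_upwards [Ioo_mem_nhdsGT (show (0 : ℝ) < 1 by norm_num)] with e he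
  obtain ⟨he0, he1⟩ := he
  have hb := Real.exp_bound (x := -e) (by rw [abs_neg, abs_of_pos he0]; exact he1.le)
    (n := 3) (by norm_num)
  rw [abs_neg, abs_of_pos he0] at hb
  simp [Finset.sum_range_succ, Nat.factorial] at hb
  have e1 : (Real.exp (-e) - 1 + e) / e ^ 2 - 1 / 2
      = (Real.exp (-e) - (1 + -e + e ^ 2 / 2)) / e ^ 2 := by
    field_simp
    ring
  rw [e1, norm_div, Real.norm_eq_abs, Real.norm_eq_abs, abs_of_pos (pow_pos he0 2),
    div_le_iff₀ (pow_pos he0 2)]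
  have : 0 < e ^ 3 := pow_pos he0 3
  nlinarith

/-- For `γ > 2`, the centered and rescaled LPSM mutant number converges to a standard
Gaussian in the large `θ = Nμ` limit: the log-Laplace transforms converge to `s²/2`. -/
theorem large_theta_gaussian_limit_gamma_gt_two
    (γ q s : ℝ) (hγ : 2 < γ) (hq0 : 0 ≤ q) (hq1 : q < 1) (hs : 0 < s)
    (a b y Λ : ℝ → ℝ)
    (ha : ∀ θ : ℝ, 1 < θ →
      a θ = (1 / (1 - q)) * Real.sqrt (θ * (γ - q * (γ - 2)) / ((γ - 1) * (γ - 2))))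
    (hb : ∀ θ : ℝ, 1 < θ → b θ = θ / ((1 - q) * (γ - 1) * a θ))
    (hy : ∀ θ : ℝ, 1 < θ → y θ = (Real.exp (-s / a θ) - q) / (1 - q))
    (hΛ : ∀ θ : ℝ, 1 < θ →
      Λ θ = -(θ / γ) * (1 - y θ) *
        ∑' k : ℕ, ((Nat.factorial k : ℝ) / (ascPochhammer ℝ k).eval (1 + γ)) * (y θ) ^ k) :
    Tendsto (fun θ : ℝ => Λ θ + b θ * s) atTop (nhds (s ^ 2 / 2)) := by
  have hq : 0 < 1 - q := by linarith
  have hg0 : 0 < γ := by linarith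
  have hg1 : 0 < γ - 1 := by linarith
  have hg2 : 0 < γ - 2 := by linarith
  obtain ⟨D, hD⟩ : ∃ D, D = γ - q * (γ - 2) := ⟨_, rfl⟩
  have hDpos : 0 < D := by rw [hD]; nlinarith
  rw [← hD] at ha
  have hapos : ∀ θ : ℝ, 1 < θ → 0 < a θ := by
    intro θ hθ
    rw [ha θ hθ]
    have : 0 < θ := by linarith
    positivity
  have hasq : ∀ θ : ℝ, 1 < θ → θ = (1 - q) ^ 2 * (γ - 1) * (γ - 2) / D * a θ ^ 2 := by
    intro θ hθ
    have : 0 < θ := by linarith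
    rw [ha θ hθ, mul_pow, Real.sq_sqrt (by positivity)]
    field_simp
  have hainf : Tendsto a atTop atTop := by
    have h1 : Tendsto (fun θ : ℝ => (1 / (1 - q)) * Real.sqrt (θ * (D / ((γ - 1) * (γ - 2)))))
        atTop atTop :=
      (Real.tendsto_sqrt_atTop.comp (tendsto_id.atTop_mul_const (by positivity))).const_mul_atTop
        (by positivity)
    refine h1.congr' ?_
    filter_upwards [eventually_gt_atTop 1] with θ hθ
    rw [ha θ hθ, mul_div_assoc]
  have hε0 : Tendsto (fun θ => s / a θ) atTop (𝓝 0) := hainf.const_div_atTop s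
  have hε : Tendsto (fun θ => s / a θ) atTop (𝓝[>] 0) := by
    refine tendsto_nhdsWithin_iff.2 ⟨hε0, ?_⟩
    filter_upwards [eventually_gt_atTop 1] with θ hθ
    exact div_pos hs (hapos θ hθ)
  have hy1 : Tendsto y atTop (𝓝 1) := by
    have h1 : Tendsto (fun θ => (Real.exp (-(s / a θ)) - q) / (1 - q)) atTop
        (𝓝 ((Real.exp (-0) - q) / (1 - q))) :=
      (((Real.continuous_exp.tendsto _).comp hε0.neg).sub_const q).div_const _
    rw [neg_zero, Real.exp_zero, div_self hq.ne'] at h1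
    refine h1.congr' ?_
    filter_upwards [eventually_gt_atTop 1] with θ hθ
    rw [hy θ hθ, neg_div]
  have hyb : ∀ᶠ θ in atTop, 0 ≤ y θ ∧ y θ ≤ 1 := by
    filter_upwards [eventually_gt_atTop 1, hy1.eventually (lt_mem_nhds one_pos)] with θ hθ h0
    refine ⟨h0.le, ?_⟩
    rw [hy θ hθ, div_le_one hq, neg_div]
    have : Real.exp (-(s / a θ)) ≤ 1 :=
      Real.exp_le_one_iff.2 (neg_nonpos.2 (div_pos hs (hapos θ hθ)).le)
    linarith
  have hG := GG_lim γ hγ y hy1 hyb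
  have hE := exp_lim.comp hε
  have hE1 := (hε0.mul hE).const_sub 1
  have hfin := (((hE.const_mul (1 / ((γ - 1) * (1 - q)))).add
    (((hE1.pow 2).mul hG).const_mul (1 / (γ * (1 - q) ^ 2)))).const_mul
      ((1 - q) ^ 2 * (γ - 1) * (γ - 2) / D * s ^ 2))
  have hval : (1 - q) ^ 2 * (γ - 1) * (γ - 2) / D * s ^ 2 *
      (1 / ((γ - 1) * (1 - q)) * (1 / 2) + 1 / (γ * (1 - q) ^ 2) *
        ((1 - 0 * (1 / 2)) ^ 2 * (γ / ((γ - 1) * (γ - 2))))) = s ^ 2 / 2 := by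
    field_simp
    rw [hD]
    ring
  rw [hval] at hfin
  refine hfin.congr' ?_
  filter_upwards [eventually_gt_atTop 1, hyb] with θ hθ hyθ
  have hF := F_eq γ (y θ) hγ hyθ.1 hyθ.2
  unfold cc at hF
  rw [hΛ θ hθ, hF, hb θ hθ]
  have hA := hapos θ hθ
  have hδ : 1 - y θ = (1 - Real.exp (-(s / a θ))) / (1 - q) := by
    rw [hy θ hθ, neg_div]
    field_simp
    ring
  rw [hδ]
  generalize GG γ (y θ) = G
  have hT := hasq θ hθ
  simp only [Function.comp]
  generalize Real.exp (-(s / a θ)) = E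
  generalize a θ = A at *
  rw [hT]
  field_simp
  ring
end

section
/- Let q ∈ [0,1) and s > 0 be reals. For θ > 1 define a(θ) = θ/(1−q), y(θ) = (e^{−s/a(θ)} − q)/(1−q), and Λ(θ) = θ · ((1 − y(θ))/y(θ)) · log(1 − y(θ)). Then lim_{θ→∞} [Λ(θ) + s·log θ] = s·log s. -/
open Filter Topology

/-- Neutral case `γ = 1`: in the large `θ = Nμ` limit the centered and rescaled LPSM
mutant number converges to the Landau distribution, with log-Laplace limit `s·log s`. -/
theorem large_theta_landau_limit_gamma_one
    (q s : ℝ) (hq0 : 0 ≤ q) (hq1 : q < 1) (hs : 0 < s)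
    (a y Λ : ℝ → ℝ)
    (ha : ∀ θ : ℝ, 1 < θ → a θ = θ / (1 - q))
    (hy : ∀ θ : ℝ, 1 < θ → y θ = (Real.exp (-s / a θ) - q) / (1 - q))
    (hΛ : ∀ θ : ℝ, 1 < θ →
      Λ θ = θ * ((1 - y θ) / y θ) * Real.log (1 - y θ)) :
    Tendsto (fun θ : ℝ => Λ θ + s * Real.log θ) atTop (nhds (s * Real.log s)) := by
  have hp : 0 < 1 - q := by linarith
  set c := s * (1 - q) with hc
  have hcpos : 0 < c := mul_pos hs hp
  set w : ℝ → ℝ := fun θ => (1 - Real.exp (-(c / θ))) / (1 - q) with hw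
  set u : ℝ → ℝ := fun θ => θ * w θ with hu
  have hinv : Tendsto (fun θ : ℝ => θ⁻¹) atTop (𝓝 0) := tendsto_inv_atTop_zero
  have hlog : Tendsto (fun θ : ℝ => Real.log θ / θ) atTop (𝓝 0) :=
    Real.isLittleO_log_id_atTop.tendsto_div_nhds_zero
  have hbound : ∀ᶠ θ : ℝ in atTop, |u θ - s| ≤ c ^ 2 / (1 - q) * θ⁻¹ := by
    filter_upwards [eventually_ge_atTop c, eventually_gt_atTop 1] with θ h1 h2
    have hθ : 0 < θ := by linarith
    have hx : |-(c / θ)| ≤ 1 := by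
      rw [abs_neg, abs_of_pos (div_pos hcpos hθ), div_le_one hθ]; exact h1
    have h := Real.abs_exp_sub_one_sub_id_le hx
    have e : u θ - s = -(θ / (1 - q)) * (Real.exp (-(c / θ)) - 1 - -(c / θ)) := by
      simp only [hu, hw, hc]
      field_simp
      ring
    rw [e, abs_mul, abs_neg, abs_of_pos (div_pos hθ hp)]
    calc _ ≤ θ / (1 - q) * (-(c / θ)) ^ 2 := by gcongr
      _ = _ := by field_simp
  have hus : Tendsto (fun θ => u θ - s) atTop (𝓝 0) := by
    apply squeeze_zero_norm' hbound
    simpa using hinv.const_mul (c ^ 2 / (1 - q))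
  have hu1 : Tendsto u atTop (𝓝 s) := by
    simpa using hus.add_const s
  have husl : Tendsto (fun θ => (u θ - s) * Real.log θ) atTop (𝓝 0) := by
    apply squeeze_zero_norm' (a := fun θ => c ^ 2 / (1 - q) * (Real.log θ / θ))
    · filter_upwards [hbound, eventually_gt_atTop 1] with θ h1 h2
      have hl : 0 < Real.log θ := Real.log_pos h2
      rw [Real.norm_eq_abs, abs_mul, abs_of_pos hl]
      calc _ ≤ c ^ 2 / (1 - q) * θ⁻¹ * Real.log θ := by gcongr
        _ = _ := by ring
    · simpa using hlog.const_mul (c ^ 2 / (1 - q))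
  have hw0 : Tendsto w atTop (𝓝 0) := by
    have := hu1.mul hinv
    rw [mul_zero] at this
    refine this.congr' ?_
    filter_upwards [eventually_gt_atTop 1] with θ h2
    have hθ : θ ≠ 0 := by linarith
    simp only [hu]
    field_simp
  have hwl : Tendsto (fun θ => u θ * (Real.log θ / θ)) atTop (𝓝 0) := by
    simpa using hu1.mul hlog
  have hd : Tendsto (fun θ => 1 - w θ) atTop (𝓝 1) := by
    simpa using hw0.const_sub 1
  have hmain : Tendsto (fun θ => u θ / (1 - w θ) * Real.log (u θ)
      - ((u θ - s) * Real.log θ + s * (u θ * (Real.log θ / θ))) / (1 - w θ)) atTop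
      (𝓝 (s * Real.log s)) := by
    have h1 := (hu1.div hd one_ne_zero).mul (hu1.log hs.ne')
    have h2 := (husl.add (hwl.const_mul s)).div hd one_ne_zero
    simpa using h1.sub h2
  refine hmain.congr' ?_
  filter_upwards [eventually_gt_atTop 1, hu1.eventually (lt_mem_nhds hs),
    hd.eventually (lt_mem_nhds one_pos)] with θ h1 h2 h3
  have hθ : 0 < θ := by linarith
  have hyw : y θ = 1 - w θ := by
    rw [hy θ h1, ha θ h1]
    have : -s / (θ / (1 - q)) = -(c / θ) := by
      rw [hc]; field_simp
    rw [this]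
    simp only [hw]
    field_simp
    ring
  have hwpos : 0 < w θ := by
    have h2' : 0 < θ * w θ := h2
    exact pos_of_mul_pos_right h2' hθ.le
  have hlu : Real.log (u θ) = Real.log θ + Real.log (w θ) :=
    Real.log_mul hθ.ne' hwpos.ne'
  have huw : u θ = θ * w θ := rfl
  rw [hΛ θ h1, hyw, hlu, huw, sub_sub_cancel]
  clear_value w
  field_simp
  ring
end

section
/- Let q ∈ [0,1) and s > 0 be reals. For θ > e define a(θ) = √(θ·log θ)/(1−q), b(θ) = √(θ/log θ), y(θ) = (e^{−s/a(θ)} − q)/(1−q), and Λ(θ) = −θ(1 − y(θ)) · (y(θ) + (1 − y(θ))·log(1 − y(θ))) / y(θ)². Then lim_{θ→∞} [Λ(θ) + b(θ)·s] = s²/2. -/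
open Filter Topology

/-- Boundary case `γ = 2`: in the large `θ = Nμ` limit the centered and rescaled LPSM
mutant number converges to a standard Gaussian, with scaling `√(θ log θ)`. -/
theorem large_theta_gaussian_limit_gamma_two
    (q s : ℝ) (hq0 : 0 ≤ q) (hq1 : q < 1) (hs : 0 < s)
    (a b y Λ : ℝ → ℝ)
    (ha : ∀ θ : ℝ, Real.exp 1 < θ → a θ = Real.sqrt (θ * Real.log θ) / (1 - q))
    (hb : ∀ θ : ℝ, Real.exp 1 < θ → b θ = Real.sqrt (θ / Real.log θ))
    (hy : ∀ θ : ℝ, Real.exp 1 < θ → y θ = (Real.exp (-s / a θ) - q) / (1 - q))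
    (hΛ : ∀ θ : ℝ, Real.exp 1 < θ →
      Λ θ = -θ * (1 - y θ) * (y θ + (1 - y θ) * Real.log (1 - y θ)) / (y θ) ^ 2) :
    Tendsto (fun θ : ℝ => Λ θ + b θ * s) atTop (nhds (s ^ 2 / 2)) := by
  have hq : 0 < 1 - q := by linarith
  set L : ℝ → ℝ := fun θ => Real.log θ with hL
  set w : ℝ → ℝ := fun θ => s / Real.sqrt (θ * Real.log θ) with hw
  set u : ℝ → ℝ := fun θ => (1 - Real.exp (-((1 - q) * w θ))) / (1 - q) with hu
  set r : ℝ → ℝ := fun θ => u θ / w θ with hr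
  have tL : Tendsto L atTop atTop := Real.tendsto_log_atTop
  have tiL : Tendsto (fun θ => (L θ)⁻¹) atTop (𝓝 0) := tendsto_inv_atTop_zero.comp tL
  have tLL : Tendsto (fun θ => Real.log (L θ) / L θ) atTop (𝓝 0) := by
    have h : Tendsto (fun x : ℝ => Real.log x / x) atTop (𝓝 0) :=
      Real.isLittleO_log_id_atTop.tendsto_div_nhds_zero
    exact h.comp tL
  have tw : Tendsto w atTop (𝓝 0) := by
    apply Tendsto.const_div_atTop
    exact Real.tendsto_sqrt_atTop.comp (tendsto_id.atTop_mul_atTop₀ tL)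
  have hbig : ∀ᶠ θ : ℝ in atTop, Real.exp 1 < θ := eventually_gt_atTop _
  have basic : ∀ θ : ℝ, Real.exp 1 < θ → 0 < θ ∧ 1 < L θ ∧ 0 < w θ ∧ θ * w θ ^ 2 = s ^ 2 * (L θ)⁻¹ := by
    intro θ h
    have h0 : 0 < θ := (Real.exp_pos 1).trans h
    have h1 : 1 < Real.log θ := by rwa [Real.lt_log_iff_exp_lt h0]
    have h2 : 0 < θ * Real.log θ := by positivity
    refine ⟨h0, h1, div_pos hs (Real.sqrt_pos.2 h2), ?_⟩
    simp only [hw, hL, div_pow]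
    rw [Real.sq_sqrt h2.le]
    field_simp
  have huw : ∀ᶠ θ : ℝ in atTop, |u θ - w θ| ≤ w θ ^ 2 := by
    filter_upwards [hbig, tw.eventually (ge_mem_nhds (show (0:ℝ) < 1 by norm_num))] with θ h h1
    obtain ⟨h0, hL1, hwp, -⟩ := basic θ h
    have e1 : |-((1 - q) * w θ)| ≤ 1 := by
      rw [abs_neg, abs_of_pos (by positivity)]
      nlinarith
    have e2 := Real.abs_exp_sub_one_sub_id_le e1
    have e3 : u θ - w θ = -((Real.exp (-((1 - q) * w θ)) - 1 - -((1 - q) * w θ)) / (1 - q)) := by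
      simp only [hu]
      field_simp
      ring
    rw [e3, abs_neg, abs_div, abs_of_pos hq, div_le_iff₀ hq]
    refine e2.trans ?_
    have : 0 ≤ w θ ^ 2 * (1 - q) := by positivity
    nlinarith
  have tA : Tendsto (fun θ => θ * (w θ - u θ)) atTop (𝓝 0) := by
    have h := tiL.const_mul (s ^ 2)
    rw [mul_zero] at h
    refine squeeze_zero_norm' ?_ h
    filter_upwards [hbig, huw] with θ h h1
    obtain ⟨h0, hL1, hwp, he⟩ := basic θ h
    rw [← he, Real.norm_eq_abs, abs_mul, abs_of_pos h0, abs_sub_comm]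
    gcongr
  have tr : Tendsto r atTop (𝓝 1) := by
    rw [← tendsto_sub_nhds_zero_iff]
    refine squeeze_zero_norm' ?_ tw
    filter_upwards [hbig, huw] with θ h h1
    obtain ⟨h0, hL1, hwp, he⟩ := basic θ h
    have : r θ - 1 = (u θ - w θ) / w θ := by
      simp only [hr]
      field_simp
    rw [this, Real.norm_eq_abs, abs_div, abs_of_pos hwp, div_le_iff₀ hwp]
    nlinarith
  have tu : Tendsto u atTop (𝓝 0) := by
    have h := tr.mul tw
    rw [mul_zero] at h
    refine h.congr' ?_
    filter_upwards [hbig] with θ h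
    obtain ⟨h0, hL1, hwp, he⟩ := basic θ h
    simp only [hr]
    field_simp
  have t1u : Tendsto (fun θ => 1 - u θ) atTop (𝓝 1) := by
    simpa using tu.const_sub 1
  have tlr : Tendsto (fun θ => Real.log (r θ)) atTop (𝓝 0) := by
    simpa using tr.log one_ne_zero
  have key : Tendsto (fun θ => θ * (w θ - u θ) - s ^ 2 * (L θ)⁻¹ * (r θ ^ 2 / (1 - u θ))
      - s ^ 2 * ((Real.log s + Real.log (r θ)) * (L θ)⁻¹ - 1 / 2 - Real.log (L θ) / L θ / 2)
        * (r θ ^ 2 / (1 - u θ) ^ 2)) atTop (𝓝 (s ^ 2 / 2)) := by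
    have h := (tA.sub ((tiL.const_mul (s ^ 2)).mul ((tr.pow 2).div t1u one_ne_zero))).sub
      ((((((tlr.const_add (Real.log s)).mul tiL).sub_const (1 / 2)).sub (tLL.div_const 2)).const_mul
        (s ^ 2)).mul ((tr.pow 2).div (t1u.pow 2) (by norm_num)))
    convert h using 2
    norm_num
    ring
  refine key.congr' ?_
  filter_upwards [hbig, tr.eventually (lt_mem_nhds (show (0:ℝ) < 1 by norm_num)),
    t1u.eventually (lt_mem_nhds (show (0:ℝ) < 1 by norm_num))] with θ h hrp hup
  obtain ⟨h0, hL1, hwp, he⟩ := basic θ h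
  have hLp : 0 < L θ := by linarith
  have hy' : 1 - y θ = u θ := by
    rw [hy θ h, ha θ h]
    have : -s / (Real.sqrt (θ * Real.log θ) / (1 - q)) = -((1 - q) * w θ) := by
      simp only [hw]
      rw [div_div_eq_mul_div]
      ring
    rw [this]
    simp only [hu]
    field_simp
    ring
  have hy2 : y θ = 1 - u θ := by linarith
  have hur : u θ = r θ * w θ := by
    simp only [hr]
    field_simp
  have hbw : b θ * s = θ * w θ := by
    rw [hb θ h]
    have h2 : 0 < Real.log θ := hLp
    simp only [hw]
    rw [Real.sqrt_div h0.le, Real.sqrt_mul h0.le]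
    have h3 := Real.sqrt_pos.2 h0
    have h4 := Real.sqrt_pos.2 h2
    field_simp
    rw [Real.sq_sqrt h0.le]
  have hlog : Real.log (u θ) = Real.log s + Real.log (r θ) - L θ / 2 - Real.log (L θ) / 2 := by
    rw [hur, Real.log_mul hrp.ne' hwp.ne']
    have h2 : 0 < Real.log θ := hLp
    simp only [hw, hL]
    rw [Real.log_div hs.ne' (Real.sqrt_pos.2 (by positivity)).ne', Real.log_sqrt (by positivity),
      Real.log_mul h0.ne' h2.ne']
    ring
  have hlog2 : (Real.log s + Real.log (r θ)) * (L θ)⁻¹ - 1 / 2 - Real.log (L θ) / L θ / 2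
      = (L θ)⁻¹ * Real.log (u θ) := by
    rw [hlog]
    field_simp
  have hru : s ^ 2 * (L θ)⁻¹ * r θ ^ 2 = θ * u θ ^ 2 := by
    rw [← he, hur]
    ring
  rw [hΛ θ h, hy', hbw, hlog2, hy2]
  have e1 : s ^ 2 * (L θ)⁻¹ * (r θ ^ 2 / (1 - u θ)) = θ * u θ ^ 2 / (1 - u θ) := by
    rw [← hru]
    ring
  have e2 : s ^ 2 * ((L θ)⁻¹ * Real.log (u θ)) * (r θ ^ 2 / (1 - u θ) ^ 2)
      = θ * u θ ^ 2 * Real.log (u θ) / (1 - u θ) ^ 2 := by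
    rw [← hru]
    ring
  rw [e1, e2]
  generalize Real.log (u θ) = l
  have hne := hup.ne'
  field_simp
  ring
end

section
/- Let q ∈ [0,1), μ > 0 and s > 0 be reals. For N > 1 define z_N = e^{−s(1−q)/N}, ξ_N = (q − z_N)/(1 − z_N), and Λ_N = (Nμ/ξ_N) · log((1 − ξ_N)/(1 − ξ_N/N)). Then lim_{N→∞} [Λ_N + μ(1 + log N)·s] = μ·s·(1 + log(1+s)). -/
open Filter Topology

/-- Large population limit at fixed mutation rate in the neutral case `γ = 1`:
the centered and rescaled mutant number converges with log-Laplace limit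
`−μs(1+log(1+s))`, i.e. `Λ_N + μ(1+log N)s → μs(1+log(1+s))`. -/
theorem large_N_fixed_mutation_neutral_limit
    (q μ s : ℝ) (hq0 : 0 ≤ q) (hq1 : q < 1) (hμ : 0 < μ) (hs : 0 < s)
    (z ξ Λ : ℝ → ℝ)
    (hz : ∀ N : ℝ, 1 < N → z N = Real.exp (-(s * (1 - q)) / N))
    (hξ : ∀ N : ℝ, 1 < N → ξ N = (q - z N) / (1 - z N))
    (hΛ : ∀ N : ℝ, 1 < N →
      Λ N = (N * μ / ξ N) * Real.log ((1 - ξ N) / (1 - ξ N / N))) :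
    Tendsto (fun N : ℝ => Λ N + μ * (1 + Real.log N) * s) atTop
      (nhds (μ * s * (1 + Real.log (1 + s)))) := by
  have h1q : 0 < 1 - q := by linarith
  set c : ℝ := s * (1 - q) with hc
  have hcpos : 0 < c := mul_pos hs h1q
  set r : ℝ → ℝ := fun N => N * (1 - Real.exp (-c / N)) with hr
  have hinv : Tendsto (fun N : ℝ => N⁻¹) atTop (𝓝 0) := tendsto_inv_atTop_zero
  have hlog : Tendsto (fun N : ℝ => Real.log N / N) atTop (𝓝 0) := by
    have := Real.isLittleO_log_id_atTop.tendsto_div_nhds_zero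
    simpa using this
  have hub : ∀ N : ℝ, 0 < N → r N ≤ c := by
    intro N hN
    have h := Real.add_one_le_exp (-c / N)
    have h2 : 1 - Real.exp (-c / N) ≤ c / N := by
      have : -c / N = -(c / N) := by ring
      linarith
    calc r N ≤ N * (c / N) := mul_le_mul_of_nonneg_left h2 hN.le
      _ = c := by field_simp
  have hlb : ∀ N : ℝ, 0 < N → c - r N ≤ c ^ 2 / N := by
    intro N hN
    have h := Real.add_one_le_exp (c / N)
    have hp : 0 < c / N := div_pos hcpos hN
    have h2 : Real.exp (-c / N) ≤ (1 + c / N)⁻¹ := by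
      rw [neg_div, Real.exp_neg]
      exact inv_anti₀ (by linarith) (by linarith)
    have h3 : (1 + c / N)⁻¹ ≤ 1 - c / N + (c / N) ^ 2 := by
      rw [inv_le_iff_one_le_mul₀ (by linarith)]
      nlinarith [pow_pos hp 3]
    have h4 : N * (c / N - (c / N) ^ 2) ≤ r N :=
      mul_le_mul_of_nonneg_left (by linarith) hN.le
    have h5 : N * (c / N - (c / N) ^ 2) = c - c ^ 2 / N := by field_simp
    linarith
  have hrpos : ∀ N : ℝ, 0 < N → 0 < r N := by
    intro N hN
    refine mul_pos hN ?_
    have : Real.exp (-c / N) < 1 := by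
      rw [Real.exp_lt_one_iff]
      exact div_neg_of_neg_of_pos (by linarith) hN
    linarith
  have hrlog : Tendsto (fun N => (c - r N) * Real.log N) atTop (𝓝 0) := by
    have hu : Tendsto (fun N : ℝ => c ^ 2 * (Real.log N / N)) atTop (𝓝 0) := by
      simpa using hlog.const_mul (c ^ 2)
    refine tendsto_of_tendsto_of_tendsto_of_le_of_le' tendsto_const_nhds hu ?_ ?_
    · filter_upwards [eventually_gt_atTop 1] with N hN
      exact mul_nonneg (by linarith [hub N (by linarith)]) (Real.log_nonneg hN.le)
    · filter_upwards [eventually_gt_atTop 1] with N hN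
      calc (c - r N) * Real.log N ≤ c ^ 2 / N * Real.log N :=
            mul_le_mul_of_nonneg_right (hlb N (by linarith)) (Real.log_nonneg hN.le)
        _ = _ := by ring
  have hrc : Tendsto r atTop (𝓝 c) := by
    have hu : Tendsto (fun N : ℝ => c - c ^ 2 * N⁻¹) atTop (𝓝 c) := by
      simpa using tendsto_const_nhds.sub (hinv.const_mul (c ^ 2))
    refine tendsto_of_tendsto_of_tendsto_of_le_of_le' hu tendsto_const_nhds ?_ ?_
    · filter_upwards [eventually_gt_atTop 1] with N hN
      have := hlb N (by linarith)
      rw [div_eq_mul_inv] at this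
      linarith
    · filter_upwards [eventually_gt_atTop 1] with N hN
      exact hub N (by linarith)
  have hD : Tendsto (fun N => r N * N⁻¹ - (1 - q)) atTop (𝓝 (-(1 - q))) := by
    have := (hrc.mul hinv).sub (tendsto_const_nhds (x := 1 - q))
    simpa using this
  have hDne : -(1 - q) ≠ 0 := by linarith
  have hDneg : ∀ᶠ N in atTop, r N * N⁻¹ - (1 - q) < 0 :=
    hD.eventually (eventually_lt_nhds (by linarith))
  have hA : Tendsto (fun N => (-((c - r N) * Real.log N) + s * (r N * (Real.log N / N)))
      / (r N * N⁻¹ - (1 - q))) atTop (𝓝 0) := by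
    have := (hrlog.neg.add ((hrc.mul hlog).const_mul s)).div hD hDne
    have e : (-(0:ℝ) + s * (c * 0)) / (-(1 - q)) = 0 := by simp
    rw [e] at this
    exact this
  have hB : Tendsto (fun N => r N / (r N * N⁻¹ - (1 - q))) atTop (𝓝 (-s)) := by
    have := hrc.div hD hDne
    have e : c / (-(1 - q)) = -s := by
      rw [hc]; field_simp
    rwa [e] at this
  have hC : Tendsto (fun N => Real.log ((1 - q) / r N)) atTop (𝓝 (-Real.log s)) := by
    have := ((tendsto_const_nhds (x := 1 - q)).div hrc hcpos.ne')
    have e : (1 - q) / c = s⁻¹ := by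
      rw [hc]; field_simp
    rw [e] at this
    have := this.log (by positivity)
    rwa [Real.log_inv] at this
  have hE : Tendsto (fun N => Real.log (1 - (N⁻¹ - (1 - q) / r N))) atTop
      (𝓝 (Real.log (1 + s) - Real.log s)) := by
    have := ((tendsto_const_nhds (x := (1:ℝ))).sub
      (hinv.sub ((tendsto_const_nhds (x := 1 - q)).div hrc hcpos.ne')))
    have e : 1 - (0 - (1 - q) / c) = (1 + s) / s := by
      rw [hc]; field_simp; ring
    rw [e] at this
    have := this.log (by positivity)
    rwa [Real.log_div (by positivity) (by positivity)] at this
  have hF := ((hA.add (hB.mul (hC.sub hE))).const_mul μ).add_const (μ * s)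
  have e : μ * (0 + -s * (-Real.log s - (Real.log (1 + s) - Real.log s))) + μ * s
      = μ * s * (1 + Real.log (1 + s)) := by ring
  rw [e] at hF
  refine hF.congr' ?_
  filter_upwards [eventually_gt_atTop 1, hDneg] with N hN hDN
  have hN0 : 0 < N := by linarith
  have hrN := hrpos N hN0
  have hzN : 1 - z N = r N / N := by
    rw [hz N hN, hr]; field_simp
  have hξN : ξ N = N * (N⁻¹ - (1 - q) / r N) := by
    rw [hξ N hN, hzN, show q - z N = r N / N - (1 - q) by linarith]
    field_simp
  have hfac : N⁻¹ - (1 - q) / r N = (r N * N⁻¹ - (1 - q)) / r N := by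
    field_simp
  have haneg : N⁻¹ - (1 - q) / r N < 0 := by
    rw [hfac]; exact div_neg_of_neg_of_pos hDN hrN
  have h1 : N * μ / ξ N = μ * (r N / (r N * N⁻¹ - (1 - q))) := by
    rw [hξN, hfac, mul_div_mul_left _ _ hN0.ne', div_div_eq_mul_div, mul_div_assoc]
  have h2 : ξ N / N = N⁻¹ - (1 - q) / r N := by
    rw [hξN]; field_simp
  have h3 : 1 - ξ N = N * ((1 - q) / r N) := by
    rw [hξN]; field_simp; ring
  have h4 : Real.log ((1 - ξ N) / (1 - ξ N / N)) = Real.log N + Real.log ((1 - q) / r N)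
      - Real.log (1 - (N⁻¹ - (1 - q) / r N)) := by
    rw [h2, h3, Real.log_div (by positivity) (by linarith),
      Real.log_mul hN0.ne' (by positivity)]
  rw [hΛ N hN, h1, h4]
  have key : (-((c - r N) * Real.log N) + s * (r N * (Real.log N / N)))
      / (r N * N⁻¹ - (1 - q)) = (r N / (r N * N⁻¹ - (1 - q)) + s) * Real.log N := by
    have hne : r N * N⁻¹ - (1 - q) ≠ 0 := hDN.ne
    rw [div_eq_iff hne, add_mul, add_mul, mul_right_comm (r N / _), div_mul_cancel₀ _ hne, hc]
    ring
  rw [key]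
  ring
end

section
/- Let γ > 0 be a real that is not an integer, q ∈ [0,1) and θ > 0. Define q_0 = −θ ∑_{m=0}^∞ q^m/(γ+m), and for j ≥ 1, q_j = θ · ((j−1)!/(1+γ)_j) · ∑_{m=0}^∞ ((j)_m (γ)_m / ((1+γ+j)_m · m!)) q^m. Define p : ℕ → ℝ by p_0 = e^{q_0} and p_n = (1/n) ∑_{k=0}^{n−1} (n−k) q_{n−k} p_k for n ≥ 1. Then lim_{n→∞} n^{1+γ} · p_n = θ·Γ(1+γ)/(1−q)^γ. -/
open Filter Topology

noncomputable def lpC (γ : ℝ) (k : ℕ) : ℝ :=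
  (Nat.factorial (k - 1) : ℝ) / (ascPochhammer ℝ k).eval (1 + γ)

noncomputable def lpD (γ q : ℝ) (m : ℕ) : ℝ :=
  (ascPochhammer ℝ m).eval γ / (Nat.factorial m) * q ^ m

lemma lpD_hasSum (γ q : ℝ) (hq0 : 0 ≤ q) (hq1 : q < 1) :
    HasSum (lpD γ q) (1 / (1 - q) ^ γ) := by
  have h := (Real.one_div_one_sub_rpow_hasFPowerSeriesOnBall_zero γ).hasSum (y := q) (by
    rw [Metric.mem_eball, edist_zero_right, ← ofReal_norm, Real.norm_of_nonneg hq0]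
    simpa using hq1)
  simp only [zero_add] at h
  have e : ∀ m, lpD γ q m = (FormalMultilinearSeries.ofScalars ℝ
      (fun n => Ring.choose (γ + (n:ℝ) - 1) n) m) (fun _ => q) := by
    intro m
    rw [FormalMultilinearSeries.ofScalars_apply_eq, ← Ring.multichoose_eq]
    have h2 := Ring.factorial_nsmul_multichoose_eq_ascPochhammer γ m
    rw [Polynomial.ascPochhammer_smeval_eq_eval, nsmul_eq_mul] at h2
    have h3 : (Nat.factorial m : ℝ) ≠ 0 := by positivity
    rw [lpD, ← h2, smul_eq_mul]
    field_simp
  rw [show lpD γ q = _ from funext e]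
  exact h

lemma lp_poch_prod (x : ℝ) (n : ℕ) :
    (ascPochhammer ℝ n).eval x = ∏ j ∈ Finset.range n, (x + j) := by
  induction n with
  | zero => simp
  | succ n ih => rw [ascPochhammer_succ_eval, ih, Finset.prod_range_succ]

lemma lp_poch_add (x : ℝ) (n m : ℕ) :
    (ascPochhammer ℝ (n + m)).eval x =
      (ascPochhammer ℝ n).eval x * (ascPochhammer ℝ m).eval (x + n) := by
  rw [← ascPochhammer_mul]; simp

lemma lp_gammaSeq (γ : ℝ) (n : ℕ) :
    Real.GammaSeq γ n = (n : ℝ) ^ γ * Nat.factorial n /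
      (γ * (ascPochhammer ℝ n).eval (1 + γ)) := by
  have := lp_poch_add γ 1 n
  rw [Real.GammaSeq, ← lp_poch_prod, add_comm n 1, this]
  simp [add_comm]

lemma lpC_tendsto (γ : ℝ) (hγ : 0 < γ) :
    Tendsto (fun n : ℕ => (n : ℝ) ^ (1 + γ) * lpC γ n) atTop (𝓝 (Real.Gamma (1 + γ))) := by
  have h := (Real.GammaSeq_tendsto_Gamma γ).const_mul γ
  rw [add_comm 1 γ, Real.Gamma_add_one hγ.ne']
  refine h.congr' ?_
  filter_upwards [eventually_ge_atTop 1] with n hn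
  have hp : 0 < (ascPochhammer ℝ n).eval (1 + γ) := ascPochhammer_pos _ _ (by linarith)
  obtain ⟨k, rfl⟩ := Nat.exists_eq_add_of_le' hn
  have hk : (0:ℝ) < ((k + 1 : ℕ) : ℝ) := by positivity
  rw [lp_gammaSeq, lpC, Real.rpow_add_one hk.ne', Nat.factorial_succ]
  simp only [Nat.add_sub_cancel]
  push_cast
  field_simp

lemma lpC_pos (γ : ℝ) (hγ : 0 < γ) (k : ℕ) : 0 < lpC γ k := by
  have hp : 0 < (ascPochhammer ℝ k).eval (1 + γ) := ascPochhammer_pos _ _ (by linarith)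
  unfold lpC; positivity

lemma lpC_hasSum (γ : ℝ) (hγ : 0 < γ) (m : ℕ) :
    HasSum (fun j => lpC γ (j + 1 + m))
      ((Nat.factorial m : ℝ) / ((ascPochhammer ℝ m).eval (1 + γ) * γ)) := by
  set b : ℕ → ℝ := fun n => (Nat.factorial n : ℝ) / ((ascPochhammer ℝ n).eval (1 + γ) * γ) with hb
  have hb0 : Tendsto b atTop (𝓝 0) := by
    have h1 : Tendsto (fun n : ℕ => ((n : ℝ) ^ γ)) atTop atTop :=
      (tendsto_rpow_atTop hγ).comp tendsto_natCast_atTop_atTop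
    have h := (Real.GammaSeq_tendsto_Gamma γ).div_atTop h1
    refine h.congr' ?_
    filter_upwards [eventually_ge_atTop 1] with n hn
    have hp : 0 < (ascPochhammer ℝ n).eval (1 + γ) := ascPochhammer_pos _ _ (by linarith)
    have hk : (0:ℝ) < (n : ℝ) := by exact_mod_cast hn
    have : (n:ℝ) ^ γ ≠ 0 := (Real.rpow_pos_of_pos hk _).ne'
    rw [lp_gammaSeq]
    simp only [hb]
    field_simp
  have key : ∀ n, lpC γ (n + 1) = b n - b (n + 1) := by
    intro n
    have hp : 0 < (ascPochhammer ℝ n).eval (1 + γ) := ascPochhammer_pos _ _ (by linarith)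
    have hs : (1 + γ + n) ≠ 0 := by positivity
    simp only [hb, lpC, Nat.add_sub_cancel, ascPochhammer_succ_eval, Nat.factorial_succ]
    push_cast
    field_simp
    ring
  rw [hasSum_iff_tendsto_nat_of_nonneg (fun j => (lpC_pos γ hγ _).le)]
  have : ∀ n, ∑ j ∈ Finset.range n, lpC γ (j + 1 + m) = b m - b (n + m) := by
    intro n
    induction n with
    | zero => simp
    | succ n ih =>
      rw [Finset.sum_range_succ, ih, show n + 1 + m = (n + m) + 1 by ring, key]; ring
  simp only [this]
  simpa using (tendsto_const_nhds (x := b m)).sub (hb0.comp (tendsto_add_atTop_nat m))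

lemma lpQ_term (γ q : ℝ) (hγ : 0 < γ) (j m : ℕ) (hj : 1 ≤ j) :
    ((Nat.factorial (j - 1) : ℝ) / (ascPochhammer ℝ j).eval (1 + γ)) *
     (((ascPochhammer ℝ m).eval (j : ℝ) * (ascPochhammer ℝ m).eval γ /
            ((ascPochhammer ℝ m).eval (1 + γ + j) * (Nat.factorial m))) * q ^ m)
    = lpC γ (j + m) * lpD γ q m := by
  obtain ⟨k, rfl⟩ := Nat.exists_eq_add_of_le' hj
  have h1 := factorial_mul_ascPochhammer ℝ k m
  have h2 := lp_poch_add (1 + γ) (k + 1) m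
  have hp : 0 < (ascPochhammer ℝ (k+1)).eval (1 + γ) := ascPochhammer_pos _ _ (by linarith)
  have hp' : 0 < (ascPochhammer ℝ m).eval (1 + γ + (k+1:ℕ)) :=
    ascPochhammer_pos _ _ (by positivity)
  rw [lpC, lpD, h2]
  simp only [Nat.add_sub_cancel, show k + 1 + m - 1 = k + m by omega]
  rw [← h1]
  push_cast at hp' ⊢
  field_simp

lemma lpQ_tendsto (γ q : ℝ) (hγ : 0 < γ) (hq0 : 0 ≤ q) (hq1 : q < 1) :
    Tendsto (fun n : ℕ => (n : ℝ) ^ (1 + γ) * ∑' m, lpC γ (n + m) * lpD γ q m) atTop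
      (𝓝 (Real.Gamma (1 + γ) / (1 - q) ^ γ)) := by
  have hd := lpD_hasSum γ q hq0 hq1
  have hdn : ∀ m, 0 ≤ lpD γ q m := fun m => by
    have := ascPochhammer_pos m γ hγ
    unfold lpD; positivity
  have hc := lpC_tendsto γ hγ
  obtain ⟨K, hK⟩ := hc.bddAbove_range
  have hK : ∀ n : ℕ, (n : ℝ) ^ (1 + γ) * lpC γ n ≤ K := fun n => hK ⟨n, rfl⟩
  have e : Real.Gamma (1 + γ) / (1 - q) ^ γ = ∑' m, Real.Gamma (1 + γ) * lpD γ q m := by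
    rw [tsum_mul_left, hd.tsum_eq]; ring
  rw [e]
  simp_rw [← tsum_mul_left]
  refine tendsto_tsum_of_dominated_convergence (bound := fun m => K * lpD γ q m)
    (hd.summable.mul_left K) ?_ ?_
  · intro m
    simp_rw [← mul_assoc]
    refine Tendsto.mul_const _ ?_
    have h1 : Tendsto (fun n : ℕ => ((n : ℝ) / (n + m : ℕ)) ^ (1 + γ)) atTop (𝓝 1) := by
      have : Tendsto (fun n : ℕ => ((n : ℝ) / (n + m : ℕ))) atTop (𝓝 1) := by
        have := tendsto_natCast_div_add_atTop (𝕜 := ℝ) (m : ℝ)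
        simpa using this
      simpa using this.rpow_const (p := 1 + γ) (Or.inl one_ne_zero)
    have h2 := h1.mul (hc.comp (tendsto_add_atTop_nat m))
    rw [one_mul] at h2
    refine h2.congr' ?_
    filter_upwards [eventually_ge_atTop 1] with n hn
    have hk : (0:ℝ) < ((n + m : ℕ) : ℝ) := by positivity
    have : ((n+m : ℕ):ℝ) ^ (1 + γ) ≠ 0 := (Real.rpow_pos_of_pos hk _).ne'
    simp only [Function.comp]
    rw [Real.div_rpow (by positivity) (by positivity)]
    field_simp
  · filter_upwards with n m
    have h0 := (lpC_pos γ hγ (n+m)).le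
    have := hdn m
    rw [Real.norm_of_nonneg (by positivity), ← mul_assoc]
    gcongr
    refine le_trans ?_ (hK (n + m))
    gcongr
    simp

lemma lpQ_hasSum (γ q : ℝ) (hγ : 0 < γ) (hq0 : 0 ≤ q) (hq1 : q < 1) :
    HasSum (fun j : ℕ => ∑' m, lpC γ (j + 1 + m) * lpD γ q m) (∑' m : ℕ, q ^ m / (γ + m)) := by
  have hdn : ∀ m, 0 ≤ lpD γ q m := fun m => by
    have := ascPochhammer_pos m γ hγ
    unfold lpD; positivity
  have hrow : ∀ m, HasSum (fun j => lpC γ (j + 1 + m) * lpD γ q m) (q ^ m / (γ + m)) := by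
    intro m
    have := (lpC_hasSum γ hγ m).mul_right (lpD γ q m)
    suffices hh : q ^ m / (γ + m) = (Nat.factorial m : ℝ) /
        ((ascPochhammer ℝ m).eval (1 + γ) * γ) * lpD γ q m by rw [hh]; exact this
    have h1 := lp_poch_add γ 1 m
    rw [add_comm 1 m, ascPochhammer_succ_eval] at h1
    simp at h1
    have hp : 0 < (ascPochhammer ℝ m).eval (γ + 1) := ascPochhammer_pos _ _ (by linarith)
    have hs : (γ + m) ≠ 0 := by positivity
    rw [lpD, add_comm 1 γ]
    field_simp
    linear_combination (-q ^ m) * h1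
  have hsum : Summable (fun m : ℕ => q ^ m / (γ + m)) := by
    refine Summable.of_nonneg_of_le (fun m => by positivity) (fun m => ?_)
      ((summable_geometric_of_lt_one hq0 hq1).div_const γ)
    gcongr; simp
  have hs : Summable (fun p : ℕ × ℕ => lpC γ (p.2 + 1 + p.1) * lpD γ q p.1) := by
    rw [summable_prod_of_nonneg (fun p => mul_nonneg (lpC_pos γ hγ _).le (hdn _))]
    refine ⟨fun m => (hrow m).summable, ?_⟩
    simpa only [(hrow _).tsum_eq] using hsum
  have hs' := hs.prod_symm
  have h1 := hs'.hasSum.prod_fiberwise (fun j => (hs'.prod_factor j).hasSum)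
  rw [Summable.tsum_prod' hs' (fun j => hs'.prod_factor j)] at h1
  simp only [Prod.swap] at h1
  rw [Summable.tsum_comm (f := fun m j => lpC γ (j + 1 + m) * lpD γ q m) hs] at h1
  simp only [(hrow _).tsum_eq] at h1
  exact h1

lemma lp_prod_split (f : ℕ × ℕ → ℝ) (N : ℕ) :
    ∑ p ∈ Finset.range N ×ˢ Finset.range N, f p =
      ∑ n ∈ Finset.range N, ∑ p ∈ Finset.HasAntidiagonal.antidiagonal n, f p +
      ∑ p ∈ (Finset.range N ×ˢ Finset.range N) with N ≤ p.1 + p.2, f p := by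
  rw [add_comm, ← Finset.sum_filter_add_sum_filter_not _ (fun p : ℕ × ℕ => N ≤ p.1 + p.2) f]
  congr 1
  rw [← Finset.sum_fiberwise_of_maps_to (t := Finset.range N) (g := fun p : ℕ × ℕ => p.1 + p.2)
    (fun p hp => by simp at hp ⊢; omega)]
  refine Finset.sum_congr rfl fun n hn => Finset.sum_congr ?_ fun _ _ => rfl
  ext p
  simp at hn ⊢
  omega

lemma lp_exp_bounds (r P : ℕ → ℝ) (hr : ∀ j, 0 ≤ r j) (hP : ∀ n, 0 ≤ P n) (hr0 : r 0 = 0)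
    (hrec : ∀ n : ℕ, (n : ℝ) * P n = ∑ p ∈ Finset.HasAntidiagonal.antidiagonal n, ((p.1 : ℝ) * r p.1) * P p.2)
    (N : ℕ) (hN : 1 ≤ N) :
    (∑ n ∈ Finset.range N, P n) * Real.exp (-∑ n ∈ Finset.range N, r n) ≤ P 0 ∧
    P 0 ≤ (∑ n ∈ Finset.range N, P n) * Real.exp (-∑ n ∈ Finset.range N, r n) +
      ∑ p ∈ (Finset.range N ×ˢ Finset.range N) with N ≤ p.1 + p.2, r p.1 * P p.2 := by
  set T := (Finset.range N ×ˢ Finset.range N).filter (fun p : ℕ × ℕ => N ≤ p.1 + p.2) with hT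
  set S : ℝ → ℝ := fun x => ∑ n ∈ Finset.range N, P n * x ^ n with hS
  set L : ℝ → ℝ := fun x => ∑ n ∈ Finset.range N, r n * x ^ n with hL
  set R : ℝ → ℝ := fun x => ∑ p ∈ T, ((p.1 : ℝ) / ((p.1 + p.2 : ℕ) : ℝ) * (r p.1 * P p.2)) *
    x ^ (p.1 + p.2) with hR
  set S' : ℝ → ℝ := fun x => ∑ n ∈ Finset.range N, P n * (n * x ^ (n - 1)) with hS'
  set L' : ℝ → ℝ := fun x => ∑ n ∈ Finset.range N, r n * (n * x ^ (n - 1)) with hL'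
  set R' : ℝ → ℝ := fun x => ∑ p ∈ T, ((p.1 : ℝ) / ((p.1 + p.2 : ℕ) : ℝ) * (r p.1 * P p.2)) *
    (((p.1 + p.2 : ℕ) : ℝ) * x ^ (p.1 + p.2 - 1)) with hR'
  have dS : ∀ x, HasDerivAt S (S' x) x := fun x =>
    HasDerivAt.fun_sum fun n _ => (hasDerivAt_pow n x).const_mul _
  have dL : ∀ x, HasDerivAt L (L' x) x := fun x =>
    HasDerivAt.fun_sum fun n _ => (hasDerivAt_pow n x).const_mul _
  have dR : ∀ x, HasDerivAt R (R' x) x := fun x =>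
    HasDerivAt.fun_sum fun n _ => (hasDerivAt_pow _ x).const_mul _
  have hpw : ∀ (n : ℕ) (x : ℝ), x * (n * x ^ (n - 1)) = n * x ^ n := by
    intro n x
    rcases n with _ | n
    · simp
    · simp only [Nat.add_sub_cancel]; ring
  have rel : ∀ x, 0 < x → S' x + R' x = L' x * S x := by
    intro x hx
    refine mul_left_cancel₀ hx.ne' ?_
    have e1 : x * S' x = ∑ n ∈ Finset.range N, ∑ p ∈ Finset.HasAntidiagonal.antidiagonal n,
        ((p.1 * r p.1) * x ^ p.1) * (P p.2 * x ^ p.2) := by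
      simp only [hS', Finset.mul_sum]
      refine Finset.sum_congr rfl fun n _ => ?_
      rw [mul_left_comm, hpw, mul_left_comm, ← mul_assoc, hrec, Finset.sum_mul]
      refine Finset.sum_congr rfl fun p hp => ?_
      rw [← Finset.HasAntidiagonal.mem_antidiagonal.mp hp, pow_add]; ring
    have e2 : x * R' x = ∑ p ∈ T, ((p.1 * r p.1) * x ^ p.1) * (P p.2 * x ^ p.2) := by
      simp only [hR', Finset.mul_sum]
      refine Finset.sum_congr rfl fun p hp => ?_
      have : ((p.1 + p.2 : ℕ) : ℝ) ≠ 0 := by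
        have := (Finset.mem_filter.mp hp).2
        exact_mod_cast (by omega : p.1 + p.2 ≠ 0)
      rw [mul_left_comm, hpw, pow_add]
      field_simp
    have e3 : x * (L' x * S x) = ∑ p ∈ Finset.range N ×ˢ Finset.range N,
        ((p.1 * r p.1) * x ^ p.1) * (P p.2 * x ^ p.2) := by
      rw [Finset.sum_product]
      dsimp only
      rw [← Finset.sum_mul_sum, ← mul_assoc]
      congr 1
      simp only [hL', Finset.mul_sum]
      refine Finset.sum_congr rfl fun n _ => ?_
      rw [mul_left_comm, hpw]; ring
    rw [mul_add, e1, e2, e3, lp_prod_split]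
  have R'nn : ∀ x, 0 < x → 0 ≤ R' x := fun x hx => Finset.sum_nonneg fun p _ => by
    have := hr p.1; have := hP p.2; positivity
  have Lnn : ∀ x, 0 < x → 0 ≤ L x := fun x hx => Finset.sum_nonneg fun p _ => by
    have := hr p; positivity
  set g : ℝ → ℝ := fun x => S x * Real.exp (-L x) with hg
  have dg : ∀ x, HasDerivAt g (S' x * Real.exp (-L x) + S x * (Real.exp (-L x) * (-L' x))) x :=
    fun x => (dS x).mul ((dL x).neg.exp)
  have S0 : S 0 = P 0 := by
    simp only [hS]
    rw [Finset.sum_eq_single 0] <;> simp +contextual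
    intro h; omega
  have L0 : L 0 = 0 := by
    simp only [hL]
    refine Finset.sum_eq_zero fun n _ => ?_
    rcases n with _ | n <;> simp [hr0]
  have R0 : R 0 = 0 := by
    simp only [hR]
    refine Finset.sum_eq_zero fun p hp => ?_
    have := (Finset.mem_filter.mp hp).2
    rw [zero_pow (by omega)]; simp
  have S1 : S 1 = ∑ n ∈ Finset.range N, P n := by simp [hS]
  have L1 : L 1 = ∑ n ∈ Finset.range N, r n := by simp [hL]
  have R1 : R 1 ≤ ∑ p ∈ T, r p.1 * P p.2 := by
    simp only [hR]
    refine Finset.sum_le_sum fun p hp => ?_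
    have := hr p.1; have := hP p.2
    rw [one_pow, mul_one]
    refine mul_le_of_le_one_left (by positivity) (div_le_one_of_le₀ (by push_cast; simp) (by positivity))
  have g0 : g 0 = P 0 := by simp [hg, S0, L0]
  have up : AntitoneOn g (Set.Icc 0 1) := by
    refine antitoneOn_of_deriv_nonpos (convex_Icc 0 1)
      (fun x _ => (dg x).continuousAt.continuousWithinAt)
      (fun x _ => (dg x).differentiableAt.differentiableWithinAt) fun x hx => ?_
    rw [interior_Icc] at hx
    rw [(dg x).deriv]
    have h1 := rel x hx.1
    have h2 := R'nn x hx.1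
    have h3 := Real.exp_pos (-L x)
    have : S' x * Real.exp (-L x) + S x * (Real.exp (-L x) * (-L' x)) =
      -(R' x * Real.exp (-L x)) := by linear_combination Real.exp (-L x) * h1
    rw [this]
    have := mul_nonneg h2 h3.le
    linarith
  have lo : MonotoneOn (fun x => g x + R x) (Set.Icc 0 1) := by
    have dh := fun x => (dg x).add (dR x)
    refine monotoneOn_of_deriv_nonneg (convex_Icc 0 1)
      (fun x _ => (dh x).continuousAt.continuousWithinAt)
      (fun x _ => (dh x).differentiableAt.differentiableWithinAt) fun x hx => ?_
    rw [interior_Icc] at hx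
    have h0 : deriv (fun x => g x + R x) x = _ := (dh x).deriv
    rw [h0]
    have h1 := rel x hx.1
    have h2 := R'nn x hx.1
    have h3 : Real.exp (-L x) ≤ 1 := by
      rw [Real.exp_le_one_iff]; linarith [Lnn x hx.1]
    have : S' x * Real.exp (-L x) + S x * (Real.exp (-L x) * (-L' x)) + R' x =
      R' x * (1 - Real.exp (-L x)) := by linear_combination Real.exp (-L x) * h1
    rw [this]
    exact mul_nonneg h2 (by linarith)
  have u := up (show (0:ℝ) ∈ Set.Icc 0 1 by simp) (show (1:ℝ) ∈ Set.Icc 0 1 by simp) zero_le_one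
  have l := lo (show (0:ℝ) ∈ Set.Icc 0 1 by simp) (show (1:ℝ) ∈ Set.Icc 0 1 by simp) zero_le_one
  simp only [g0, R0] at u l
  simp only [hg, S1, L1] at u l
  exact ⟨u, by linarith⟩

lemma lp_hasSum (r P : ℕ → ℝ) (A : ℝ) (hr : ∀ j, 0 ≤ r j) (hP : ∀ n, 0 ≤ P n) (hr0 : r 0 = 0)
    (hA : HasSum r A) (hP0 : P 0 = Real.exp (-A))
    (hrec : ∀ n : ℕ, (n : ℝ) * P n = ∑ p ∈ Finset.HasAntidiagonal.antidiagonal n, ((p.1 : ℝ) * r p.1) * P p.2) :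
    HasSum P 1 := by
  have hb := lp_exp_bounds r P hr hP hr0 hrec
  have hle : ∀ N, ∑ n ∈ Finset.range N, P n ≤ 1 := by
    intro N
    refine le_trans (Finset.sum_le_sum_of_subset_of_nonneg
      (Finset.range_mono (Nat.le_succ N)) fun _ _ _ => hP _) ?_
    have h1 := (hb (N + 1) (by omega)).1
    have h2 := hA.summable.sum_le_tsum (Finset.range (N+1)) (fun _ _ => hr _)
    rw [hA.tsum_eq] at h2
    rw [hP0] at h1
    have h3 : Real.exp (-A) ≤ Real.exp (-∑ n ∈ Finset.range (N+1), r n) :=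
      Real.exp_le_exp.mpr (by linarith)
    have h4 := Real.exp_pos (-A)
    have h5 : 0 ≤ ∑ n ∈ Finset.range (N+1), P n := Finset.sum_nonneg fun _ _ => hP _
    have := mul_le_mul_of_nonneg_left h3 h5
    by_contra hc
    push Not at hc
    simp only [Nat.succ_eq_add_one] at hc
    nlinarith
  have hs : Summable P := summable_of_sum_range_le hP hle
  have hS := hs.hasSum
  have hup : ∑' n, P n ≤ 1 := hs.tsum_le_of_sum_range_le hle
  have tP := hS.tendsto_sum_nat
  have tr := hA.tendsto_sum_nat
  have tT : Tendsto (fun N => ∑ p ∈ (Finset.range N ×ˢ Finset.range N) with N ≤ p.1 + p.2,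
      r p.1 * P p.2) atTop (𝓝 0) := by
    have nr : Summable (fun n => ‖r n‖) := hA.summable.norm
    have nP : Summable (fun n => ‖P n‖) := hs.norm
    have c1 := tsum_mul_tsum_eq_tsum_sum_antidiagonal_of_summable_norm nr nP
    have c2 := (summable_norm_sum_mul_antidiagonal_of_summable_norm nr nP).of_norm
    have c3 := c2.hasSum.tendsto_sum_nat
    rw [← c1, hA.tsum_eq] at c3
    have c4 := (tr.mul tP).sub c3
    rw [sub_self] at c4
    refine c4.congr fun N => ?_
    have := lp_prod_split (fun p => r p.1 * P p.2) N
    rw [Finset.sum_product, ← Finset.sum_mul_sum] at this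
    rw [this]; ring
  have lim := (tP.mul (Real.continuous_exp.tendsto _ |>.comp tr.neg)).add tT
  have lo := ge_of_tendsto lim (b := P 0) (by
    filter_upwards [eventually_ge_atTop 1] with N hN using (hb N hN).2)
  rw [hP0, add_zero] at lo
  have h4 := Real.exp_pos (-A)
  have : 1 ≤ ∑' n, P n := by
    by_contra hc
    push Not at hc
    nlinarith
  rwa [le_antisymm hup this] at hS

lemma lp_asymp (γ C : ℝ) (hγ : 0 < γ) (r P : ℕ → ℝ) (hr : ∀ j, 0 ≤ r j) (hP : ∀ n, 0 ≤ P n)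
    (hs : HasSum P 1)
    (hC : Tendsto (fun n : ℕ => (n : ℝ) ^ (1 + γ) * r n) atTop (𝓝 C))
    (hrec : ∀ n : ℕ, (n : ℝ) * P n =
      ∑ k ∈ Finset.range n, (((n - k : ℕ) : ℝ) * r (n - k)) * P k) :
    Tendsto (fun n : ℕ => (n : ℝ) ^ (1 + γ) * P n) atTop (𝓝 C) := by
  set a : ℕ → ℝ := fun j => (j : ℝ) * r j with ha
  have ann : ∀ j, 0 ≤ a j := fun j => mul_nonneg (by positivity) (hr j)
  have hrw : ∀ (n : ℕ) (x : ℝ), (n : ℝ) ^ (1 + γ) * x = (n : ℝ) ^ γ * (n * x) := by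
    intro n x
    rw [Real.rpow_add_of_nonneg (by positivity) (by positivity) hγ.le, Real.rpow_one]; ring
  have haC : Tendsto (fun n : ℕ => (n : ℝ) ^ γ * a n) atTop (𝓝 C) := by
    simpa only [hrw] using hC
  obtain ⟨K, hK⟩ := haC.bddAbove_range
  have hK : ∀ n : ℕ, (n : ℝ) ^ γ * a n ≤ K := fun n => hK ⟨n, rfl⟩
  have hK0 : 0 ≤ K := le_trans (mul_nonneg (by positivity) (ann 0)) (hK 0)
  have ha0 : Tendsto a atTop (𝓝 0) := by
    have h1 : Tendsto (fun n : ℕ => ((n : ℝ) ^ γ)) atTop atTop :=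
      (tendsto_rpow_atTop hγ).comp tendsto_natCast_atTop_atTop
    refine (haC.div_atTop h1).congr' ?_
    filter_upwards [eventually_ge_atTop 1] with n hn
    have hk : (0:ℝ) < (n : ℝ) := by exact_mod_cast hn
    have : (n:ℝ) ^ γ ≠ 0 := (Real.rpow_pos_of_pos hk _).ne'
    field_simp
  set ε : ℕ → ℝ := fun n => (n : ℝ)⁻¹ * ∑ j ∈ Finset.range n, a (j + 1) with hε
  have hε0 : Tendsto ε atTop (𝓝 0) := (ha0.comp (tendsto_add_atTop_nat 1)).cesaro
  set X : ℕ → ℝ := fun n => ∑' k, (if 2 * k ≤ n then (n : ℝ) ^ γ * a (n - k) else 0) * P k with hX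
  have hXlim : Tendsto X atTop (𝓝 C) := by
    have e : C = ∑' k, C * P k := by rw [tsum_mul_left, hs.tsum_eq, mul_one]
    rw [e]
    refine tendsto_tsum_of_dominated_convergence (bound := fun k => (2 ^ γ * K) * P k)
      (hs.summable.mul_left _) ?_ ?_
    · intro k
      refine Tendsto.mul_const _ ?_
      have h1 : Tendsto (fun n : ℕ => (((n + k : ℕ) : ℝ) / (n : ℝ)) ^ γ) atTop (𝓝 1) := by
        have : Tendsto (fun n : ℕ => (((n + k : ℕ) : ℝ) / (n : ℝ))) atTop (𝓝 1) := by
          have := (tendsto_natCast_div_add_atTop (𝕜 := ℝ) (k : ℝ)).inv₀ one_ne_zero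
          simpa using this
        simpa using this.rpow_const (p := γ) (Or.inl one_ne_zero)
      have h2 := h1.mul haC
      rw [one_mul] at h2
      rw [← tendsto_add_atTop_iff_nat k]
      refine h2.congr' ?_
      filter_upwards [eventually_ge_atTop (k + 1)] with n hn
      have hk : (0:ℝ) < (n : ℝ) := by exact_mod_cast (by omega : 0 < n)
      have : (n:ℝ) ^ γ ≠ 0 := (Real.rpow_pos_of_pos hk _).ne'
      rw [if_pos (by omega), Nat.add_sub_cancel, Real.div_rpow (by positivity) (by positivity)]
      field_simp
    · filter_upwards with n k
      have hp := hP k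
      rw [norm_mul, Real.norm_of_nonneg hp]
      gcongr
      split_ifs with h
      · have h0 := ann (n - k)
        rw [Real.norm_of_nonneg (by positivity)]
        have h1 : (n : ℝ) ^ γ ≤ 2 ^ γ * ((n - k : ℕ) : ℝ) ^ γ := by
          rw [← Real.mul_rpow (by positivity) (by positivity)]
          gcongr
          exact_mod_cast (by omega : n ≤ 2 * (n - k))
        calc (n : ℝ) ^ γ * a (n - k) ≤ (2 ^ γ * ((n - k : ℕ) : ℝ) ^ γ) * a (n - k) := by gcongr
          _ = 2 ^ γ * (((n - k : ℕ) : ℝ) ^ γ * a (n - k)) := by ring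
          _ ≤ _ := by gcongr; exact hK _
      · simp; positivity
  set Y : ℕ → ℝ := fun n => ∑ k ∈ Finset.range n,
    (if 2 * k ≤ n then 0 else (n : ℝ) ^ γ * a (n - k)) * P k with hY
  have hXY : ∀ n : ℕ, 1 ≤ n → (n : ℝ) ^ (1 + γ) * P n = X n + Y n := by
    intro n hn
    have : X n = ∑ k ∈ Finset.range n,
        (if 2 * k ≤ n then (n : ℝ) ^ γ * a (n - k) else 0) * P k := by
      refine tsum_eq_sum fun k hk => ?_
      simp at hk
      rw [if_neg (by omega), zero_mul]
    rw [this, hY, ← Finset.sum_add_distrib, hrw, hrec, Finset.mul_sum]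
    refine Finset.sum_congr rfl fun k _ => ?_
    split_ifs <;> simp only [ha] <;> ring
  have hYnn : ∀ n, 0 ≤ Y n := fun n => Finset.sum_nonneg fun k _ => by
    have := hP k; have := ann (n - k)
    split_ifs <;> positivity
  have hYle : ∀ (n : ℕ) (B : ℝ), 0 ≤ B → (∀ k < n, (k : ℝ) ^ (1 + γ) * P k ≤ B) →
      Y n ≤ B * (2 ^ (1 + γ) * ε n) := by
    intro n B hB hk
    have e : B * (2 ^ (1 + γ) * ε n) =
        ∑ k ∈ Finset.range n, B * 2 ^ (1 + γ) * (n : ℝ)⁻¹ * a (n - k) := by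
      rw [← Finset.mul_sum, ← Finset.sum_range_reflect (fun k => a (n - k))]
      simp only [hε]
      have e2 : ∑ j ∈ Finset.range n, a (n - (n - 1 - j)) = ∑ j ∈ Finset.range n, a (j + 1) := by
        refine Finset.sum_congr rfl fun j hj => ?_
        have hj := Finset.mem_range.mp hj
        rw [show n - (n - 1 - j) = j + 1 by omega]
      rw [e2]
      ring
    rw [e]
    refine Finset.sum_le_sum fun k hkn => ?_
    have hkn := Finset.mem_range.mp hkn
    have h0 := ann (n - k)
    split_ifs with h
    · rw [zero_mul]; positivity
    · have hn : (0:ℝ) < n := by exact_mod_cast (by omega : 0 < n)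
      have h1 : (n : ℝ) ^ (1 + γ) ≤ 2 ^ (1 + γ) * (k : ℝ) ^ (1 + γ) := by
        rw [← Real.mul_rpow (by positivity) (by positivity)]
        gcongr
        exact_mod_cast (by omega : n ≤ 2 * k)
      have hp := hP k
      have h2 : (n : ℝ) ^ (1 + γ) * P k ≤ 2 ^ (1 + γ) * B := by
        calc _ ≤ (2 ^ (1 + γ) * (k : ℝ) ^ (1 + γ)) * P k := by gcongr
          _ = 2 ^ (1 + γ) * ((k : ℝ) ^ (1 + γ) * P k) := by ring
          _ ≤ _ := by gcongr; exact hk k hkn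
      rw [hrw] at h2
      have h3 : (n : ℝ) ^ γ * P k ≤ B * 2 ^ (1 + γ) * (n : ℝ)⁻¹ := by
        rw [← div_eq_mul_inv, le_div_iff₀ hn]; linarith
      calc _ = ((n : ℝ) ^ γ * P k) * a (n - k) := by ring
        _ ≤ _ := by gcongr
  obtain ⟨M, hM⟩ := hXlim.bddAbove_range
  have hM : ∀ n : ℕ, X n ≤ M := fun n => hM ⟨n, rfl⟩
  have hε1 : Tendsto (fun n => 2 ^ (1 + γ) * ε n) atTop (𝓝 0) := by
    simpa using hε0.const_mul (2 ^ (1 + γ))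
  obtain ⟨N, hN⟩ := eventually_atTop.mp (hε1.eventually_le_const (show (0:ℝ) < 1/2 by norm_num))
  have unn : ∀ k : ℕ, 0 ≤ (k : ℝ) ^ (1 + γ) * P k := fun k => mul_nonneg (by positivity) (hP k)
  set B : ℝ := 2 * |M| + ∑ k ∈ Finset.range (N + 1), (k : ℝ) ^ (1 + γ) * P k with hB
  have hB0 : 0 ≤ ∑ k ∈ Finset.range (N + 1), (k : ℝ) ^ (1 + γ) * P k :=
    Finset.sum_nonneg fun k _ => unn k
  have hM' := le_abs_self M
  have hM0 := abs_nonneg M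
  have hBn : 0 ≤ B := by positivity
  have hub : ∀ n : ℕ, (n : ℝ) ^ (1 + γ) * P n ≤ B := by
    intro n
    induction n using Nat.strong_induction_on with
    | _ n ih =>
      by_cases hn : n ≤ N
      · have := Finset.single_le_sum (f := fun k : ℕ => (k : ℝ) ^ (1 + γ) * P k)
          (fun k _ => unn k) (Finset.mem_range.mpr (Nat.lt_succ_of_le hn))
        simp only [Nat.succ_eq_add_one] at this
        linarith
      · rw [hXY n (by omega)]
        have h1 := hYle n B hBn ih
        have h2 := mul_le_mul_of_nonneg_left (hN n (by omega)) hBn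
        have h3 := hM n
        linarith
  have hY0 : Tendsto Y atTop (𝓝 0) := by
    refine squeeze_zero hYnn (fun n => hYle n B hBn fun k _ => hub k) ?_
    simpa using hε1.const_mul B
  have := hXlim.add hY0
  rw [add_zero] at this
  refine this.congr' ?_
  filter_upwards [eventually_ge_atTop 1] with n hn
  rw [hXY n hn]

theorem lpsm_tail_power_law
    (γ q θ : ℝ) (hγ : 0 < γ) (hγint : ∀ m : ℤ, γ ≠ m)
    (hq0 : 0 ≤ q) (hq1 : q < 1) (hθ : 0 < θ)
    (Q P : ℕ → ℝ)
    (hQ0 : Q 0 = -θ * ∑' m : ℕ, q ^ m / (γ + m))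
    (hQ : ∀ j : ℕ, 1 ≤ j →
      Q j = θ * ((Nat.factorial (j - 1) : ℝ) / (ascPochhammer ℝ j).eval (1 + γ)) *
        ∑' m : ℕ,
          ((ascPochhammer ℝ m).eval (j : ℝ) * (ascPochhammer ℝ m).eval γ /
            ((ascPochhammer ℝ m).eval (1 + γ + j) * (Nat.factorial m))) * q ^ m)
    (hP0 : P 0 = Real.exp (Q 0))
    (hP : ∀ n : ℕ, 1 ≤ n →
      P n = (1 / (n : ℝ)) * ∑ k ∈ Finset.range n, ((n : ℝ) - k) * Q (n - k) * P k) :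
    Tendsto (fun n : ℕ => (n : ℝ) ^ (1 + γ) * P n) atTop
      (nhds (θ * Real.Gamma (1 + γ) / (1 - q) ^ γ)) := by
  have hQ' : ∀ j : ℕ, 1 ≤ j → Q j = θ * ∑' m, lpC γ (j + m) * lpD γ q m := by
    intro j hj
    rw [hQ j hj, mul_assoc, ← tsum_mul_left]
    simp only [lpQ_term γ q hγ j _ hj]
  have hdn : ∀ m, 0 ≤ lpD γ q m := fun m => by
    have := ascPochhammer_pos m γ hγ
    unfold lpD; positivity
  set r : ℕ → ℝ := fun j => if j = 0 then 0 else Q j with hr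
  have hrQ : ∀ j, 1 ≤ j → r j = Q j := fun j hj => by simp [hr, show j ≠ 0 by omega]
  have hr0 : r 0 = 0 := by simp [hr]
  have hrn : ∀ j, 0 ≤ r j := by
    intro j
    rcases Nat.eq_zero_or_pos j with rfl | hj
    · rw [hr0]
    · rw [hrQ j hj, hQ' j hj]
      exact mul_nonneg hθ.le (tsum_nonneg fun m => mul_nonneg (lpC_pos γ hγ _).le (hdn m))
  have hA : HasSum r (-Q 0) := by
    rw [← hasSum_nat_add_iff' 1]
    have h := (lpQ_hasSum γ q hγ hq0 hq1).mul_left θ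
    have e : (fun n => r (n + 1)) = fun j : ℕ => θ * ∑' m, lpC γ (j + 1 + m) * lpD γ q m := by
      funext j
      rw [hrQ _ (by omega), hQ' _ (by omega)]
    rw [e, Finset.sum_range_one, hr0, hQ0]
    have e2 : -(-θ * ∑' m : ℕ, q ^ m / (γ + m)) - 0 = θ * ∑' m : ℕ, q ^ m / (γ + m) := by ring
    rw [e2]
    exact h
  have hC : Tendsto (fun n : ℕ => (n : ℝ) ^ (1 + γ) * r n) atTop
      (𝓝 (θ * Real.Gamma (1 + γ) / (1 - q) ^ γ)) := by
    have h := (lpQ_tendsto γ q hγ hq0 hq1).const_mul θ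
    rw [← mul_div_assoc] at h
    refine h.congr' ?_
    filter_upwards [eventually_ge_atTop 1] with n hn
    rw [hrQ n hn, hQ' n hn]; ring
  have hrec : ∀ n : ℕ, (n : ℝ) * P n =
      ∑ k ∈ Finset.range n, (((n - k : ℕ) : ℝ) * r (n - k)) * P k := by
    intro n
    rcases Nat.eq_zero_or_pos n with rfl | hn
    · simp
    · have hn' : (n : ℝ) ≠ 0 := by exact_mod_cast hn.ne'
      rw [hP n hn, ← mul_assoc, mul_one_div_cancel hn', one_mul]
      refine Finset.sum_congr rfl fun k hk => ?_
      have hk := Finset.mem_range.mp hk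
      rw [hrQ _ (by omega), Nat.cast_sub hk.le]
  have hrec2 : ∀ n : ℕ, (n : ℝ) * P n =
      ∑ p ∈ Finset.HasAntidiagonal.antidiagonal n, ((p.1 : ℝ) * r p.1) * P p.2 := by
    intro n
    rw [hrec, ← Finset.Nat.sum_antidiagonal_swap,
      Finset.Nat.sum_antidiagonal_eq_sum_range_succ_mk, Finset.sum_range_succ]
    simp
  have hPn : ∀ n, 0 ≤ P n := by
    intro n
    induction n using Nat.strong_induction_on with
    | _ n ih =>
      rcases Nat.eq_zero_or_pos n with rfl | hn
      · rw [hP0]; positivity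
      · have hn' : (0:ℝ) < n := by exact_mod_cast hn
        refine nonneg_of_mul_nonneg_right ?_ hn'
        rw [hrec]
        exact Finset.sum_nonneg fun k hk =>
          mul_nonneg (mul_nonneg (by positivity) (hrn _)) (ih k (Finset.mem_range.mp hk))
  have hs := lp_hasSum r P (-Q 0) hrn hPn hr0 hA (by rw [neg_neg, hP0]) hrec2
  exact lp_asymp γ _ hγ r P hrn hPn hs hC hrec
end
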